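/- arXiv:2111.10796 — 4 statements merged into one kernel-verified Lean document; each statement's English description precedes it below -/
import Mathlib

section
/- Let k ≥ 1, let l_1,...,l_k be nonnegative integers, let M = max(l_1,...,l_k), let b, c be positive integers, let q be a prime and t be a positive integer, and set P = q^t. Define A(x) = (b+c-2k)·x^M + Σ_{i=1}^{k} (x^{M+l_i} + x^{M-l_i}) ∈ ℤ[x], and define S̃_P(x) = Π Φ_n(x), where the product is over all n dividing P such that n is a prime power and the cyclotomic polynomial Φ_n(x) divides A(x). Then the circulant graph C_P(l_1,...,l_k) on ℤ/Pℤ has a perfect 2-colouring with parameters (b,c) if and only if (b+c)/gcd(b,c) divides S̃_P(1). -/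
open Polynomial

open scoped Classical

/-- The product of the cyclotomic polynomials `Φ_n` over all `n ∣ P` such that `n` is a
prime power and `Φ_n` divides `A` (the polynomial `S̃_P` / `d̃_u` of the paper). -/
noncomputable def cycloProdPP (P : ℕ) (A : Polynomial ℤ) : Polynomial ℤ :=
  ∏ n ∈ (Nat.divisors P).filter
      (fun n => IsPrimePow n ∧ Polynomial.cyclotomic n ℤ ∣ A),
    Polynomial.cyclotomic n ℤ

/-- The polynomial `A(x) = (b+c-2k)·x^M + Σ_i (x^{M+l_i} + x^{M-l_i})`, where
`M = max(l_1,...,l_k)`. -/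
noncomputable def polyA (k : ℕ) (l : Fin k → ℕ) (b c : ℕ) : Polynomial ℤ :=
  Polynomial.C ((b : ℤ) + (c : ℤ) - 2 * (k : ℤ)) * Polynomial.X ^ (Finset.univ.sup l)
    + ∑ i : Fin k,
      (Polynomial.X ^ (Finset.univ.sup l + l i) + Polynomial.X ^ (Finset.univ.sup l - l i))

/-- A perfect 2-colouring (black = `true`, white = `false`) with parameters `(b, c)` of the
circulant graph `C_P(l_1,...,l_k)` on `ℤ/Pℤ`: every black vertex has exactly `b` white
neighbours and every white vertex has exactly `c` black neighbours, counted with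
multiplicity. -/
def IsPerfectColouring (P k : ℕ) (l : Fin k → ℕ) (b c : ℕ) (f : ZMod P → Bool) : Prop :=
  (∀ v : ZMod P, f v = true →
    (∑ i : Fin k, ((if f (v + (l i : ZMod P)) = false then 1 else 0)
      + (if f (v - (l i : ZMod P)) = false then 1 else 0)) = b)) ∧
  (∀ v : ZMod P, f v = false →
    (∑ i : Fin k, ((if f (v + (l i : ZMod P)) = true then 1 else 0)
      + (if f (v - (l i : ZMod P)) = true then 1 else 0)) = c))

/-- A perfect 2-colouring (black = `true`, white = `false`) with parameters `(b, c)` of the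
infinite circulant graph `C_∞(l_1,...,l_k)` on `ℤ`. -/
def IsPerfectColouringInt (k : ℕ) (l : Fin k → ℕ) (b c : ℕ) (f : ℤ → Bool) : Prop :=
  (∀ n : ℤ, f n = true →
    (∑ i : Fin k, ((if f (n + (l i : ℤ)) = false then 1 else 0)
      + (if f (n - (l i : ℤ)) = false then 1 else 0)) = b)) ∧
  (∀ n : ℤ, f n = false →
    (∑ i : Fin k, ((if f (n + (l i : ℤ)) = true then 1 else 0)
      + (if f (n - (l i : ℤ)) = true then 1 else 0)) = c))

/-- `v` is an `m`-multitiling of `ℤ/Pℤ` with tile `u`: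
`Σ_{h ∈ ℤ/Pℤ} u(g-h)·v(h) = m` for every `g` (the residues `0,…,P-1` enumerate `ℤ/Pℤ`,
so we sum over `Finset.range P`). -/
def IsMultitiling (P : ℕ) (u v : ZMod P → ℤ) (m : ℤ) : Prop :=
  ∀ g : ZMod P, ∑ a ∈ Finset.range P, u (g - (a : ZMod P)) * v ((a : ZMod P)) = m

/-- The tile `u_{l_1,...,l_k;b,c;P}(h) = (b+c-2k)·δ_M(h) + Σ_i (δ_{M+l_i}(h) + δ_{M-l_i}(h))`
on `ℤ/Pℤ`, where `M = max(l_1,...,l_k)`. -/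
def tileU (P k : ℕ) (l : Fin k → ℕ) (b c : ℕ) : ZMod P → ℤ :=
  fun h =>
    ((b : ℤ) + (c : ℤ) - 2 * (k : ℤ)) * (if ((Finset.univ.sup l : ℕ) : ZMod P) = h then 1 else 0)
      + ∑ i : Fin k,
        ((if ((Finset.univ.sup l + l i : ℕ) : ZMod P) = h then 1 else 0)
          + (if ((Finset.univ.sup l - l i : ℕ) : ZMod P) = h then 1 else 0))

/-- The mask polynomial `Q_u(x) = Σ_{a=0}^{P-1} u(a)·x^a` of a tile `u : ℤ/Pℤ → ℤ`. -/
noncomputable def maskPoly (P : ℕ) (u : ZMod P → ℤ) : Polynomial ℤ :=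
  ∑ a ∈ Finset.range P, Polynomial.C (u (a : ZMod P)) * Polynomial.X ^ a

/-- The translation operator on functions on `ℤ/Pℤ`. -/
def shift (P : ℕ) : Module.End ℤ (ZMod P → ℤ) :=
  LinearMap.funLeft ℤ ℤ fun n => n - 1

lemma shift_pow_apply (P m : ℕ) (g : ZMod P → ℤ) (n : ZMod P) :
    (shift P ^ m) g n = g (n - m) := by
  induction m generalizing n with
  | zero => simp
  | succ m ih =>
    rw [pow_succ', Module.End.mul_apply, shift, LinearMap.funLeft_apply, ← shift, ih]
    push_cast
    congr 1
    ring

lemma aeval_shift_X_pow_sub_one (P : ℕ) : aeval (shift P) (X ^ P - 1 : ℤ[X]) = 0 := by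
  ext g : 1
  funext n
  simp [shift_pow_apply]

lemma aeval_shift_maskPoly (P : ℕ) [NeZero P] (u : ZMod P → ℤ) :
    aeval (shift P) (maskPoly P u) (Pi.single 0 1) = u := by
  funext n
  simp only [maskPoly, map_sum, map_mul, map_pow, aeval_X, aeval_C, LinearMap.sum_apply,
    Finset.sum_apply, Module.End.mul_apply, Module.algebraMap_end_apply, Pi.smul_apply,
    shift_pow_apply, smul_eq_mul, Pi.single_apply, sub_eq_zero]
  rw [Finset.sum_eq_single n.val]
  · simp
  · intro a ha han
    rw [if_neg, mul_zero]
    rintro rfl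
    exact han (ZMod.val_cast_of_lt (Finset.mem_range.1 ha)).symm
  · intro h
    exact absurd (Finset.mem_range.2 n.val_lt) h

lemma maskPoly_coeff {P : ℕ} {p : ℤ[X]} (hp : p.natDegree < P) :
    maskPoly P (fun n => p.coeff n.val) = p := by
  conv_rhs => rw [p.as_sum_range' P hp]
  refine Finset.sum_congr rfl fun a ha => ?_
  simp only [ZMod.val_cast_of_lt (Finset.mem_range.1 ha), C_mul_X_pow_eq_monomial]

lemma X_pow_sub_one_dvd_iff (P : ℕ) [NeZero P] (p : ℤ[X]) :
    X ^ P - 1 ∣ p ↔ aeval (shift P) p (Pi.single 0 1) = 0 := by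
  constructor
  · rintro ⟨r, rfl⟩
    rw [map_mul, aeval_shift_X_pow_sub_one, zero_mul, LinearMap.zero_apply]
  · intro h
    have hmonic : (X ^ P - 1 : ℤ[X]).Monic := by
      simpa using monic_X_pow_sub_C (1 : ℤ) (NeZero.ne P)
    have hdeg : (X ^ P - 1 : ℤ[X]).natDegree = P := by
      simpa using natDegree_X_pow_sub_C (n := P) (r := (1 : ℤ))
    have hlt : (p %ₘ (X ^ P - 1)).natDegree < P := by
      have h1 : (X ^ P - 1 : ℤ[X]) ≠ 1 := fun h1 => NeZero.ne P (by rw [← hdeg, h1, natDegree_one])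
      simpa only [hdeg] using natDegree_modByMonic_lt p hmonic h1
    have hmod : aeval (shift P) (p %ₘ (X ^ P - 1)) (Pi.single 0 1) = 0 := by
      rw [← modByMonic_add_div p (X ^ P - 1), map_add, map_mul, aeval_shift_X_pow_sub_one,
        zero_mul, add_zero] at h
      exact h
    rw [← modByMonic_eq_zero_iff_dvd hmonic, ← maskPoly_coeff hlt]
    have hz := aeval_shift_maskPoly P fun n => (p %ₘ (X ^ P - 1)).coeff n.val
    rw [maskPoly_coeff hlt, hmod] at hz
    rw [← hz]
    simp [maskPoly]

lemma aeval_shift_polyA_apply (P k : ℕ) (l : Fin k → ℕ) (b c : ℕ) (u : ZMod P → ℤ) (n : ZMod P) :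
    aeval (shift P) (polyA k l b c) u (n + (Finset.univ.sup l : ℕ)) =
      ((b : ℤ) + c - 2 * k) * u n + ∑ i, (u (n + l i) + u (n - l i)) := by
  simp only [polyA, map_add, map_sum, map_mul, map_pow, aeval_X, aeval_C, LinearMap.sum_apply,
    Finset.sum_apply, Module.End.mul_apply, Module.algebraMap_end_apply, Pi.smul_apply,
    Pi.add_apply, LinearMap.add_apply, shift_pow_apply, smul_eq_mul, add_sub_cancel_right]
  refine congrArg₂ _ rfl (Finset.sum_congr rfl fun i _ => ?_)
  rw [add_comm, Nat.cast_sub (Finset.le_sup (Finset.mem_univ i)), Nat.cast_add]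
  congr 2 <;> ring

lemma isPerfectColouring_iff_forall (P k : ℕ) (l : Fin k → ℕ) (b c : ℕ) (f : ZMod P → Bool) :
    IsPerfectColouring P k l b c f ↔ ∀ n, ((b : ℤ) + c - 2 * k) * (f n).toInt +
      ∑ i, ((f (n + l i)).toInt + (f (n - l i)).toInt) = c := by
  have hfalse (x : Bool) : (if x = false then 1 else 0 : ℤ) = 1 - x.toInt := by cases x <;> rfl
  have htrue (x : Bool) : (if x = true then 1 else 0 : ℤ) = x.toInt := by cases x <;> rfl
  rw [IsPerfectColouring, ← forall_and]
  refine forall_congr' fun n => ?_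
  rw [← Nat.cast_inj (R := ℤ), ← Nat.cast_inj (R := ℤ)]
  push_cast
  simp only [hfalse, htrue]
  cases f n
  · simp
  · simp only [forall_const, Bool.toInt_true, Bool.true_eq_false, IsEmpty.forall_iff, and_true,
      Finset.sum_add_distrib, Finset.sum_sub_distrib, Finset.sum_const, Finset.card_univ,
      Fintype.card_fin, nsmul_eq_mul]
    constructor <;> intro h <;> linarith

lemma isPerfectColouring_iff_dvd (P k : ℕ) [NeZero P] (l : Fin k → ℕ) (b c : ℕ)
    (f : ZMod P → Bool) :
    IsPerfectColouring P k l b c f ↔ X ^ P - 1 ∣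
      polyA k l b c * maskPoly P (fun n => (f n).toInt) - C (c : ℤ) * ∑ i ∈ Finset.range P, X ^ i := by
  have hN : ∑ i ∈ Finset.range P, (X : ℤ[X]) ^ i = maskPoly P 1 := by simp [maskPoly]
  rw [X_pow_sub_one_dvd_iff, isPerfectColouring_iff_forall, hN, map_sub, map_mul, map_mul,
    LinearMap.sub_apply, Module.End.mul_apply, Module.End.mul_apply, aeval_shift_maskPoly,
    aeval_shift_maskPoly, aeval_C, Module.algebraMap_end_apply, sub_eq_zero, funext_iff]
  refine Iff.trans ?_ (Equiv.addRight ((Finset.univ.sup l : ℕ) : ZMod P)).forall_congr_right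
  simp only [Equiv.coe_addRight, aeval_shift_polyA_apply]
  simp

lemma eval_one_polyA (k : ℕ) (l : Fin k → ℕ) (b c : ℕ) :
    (polyA k l b c).eval 1 = b + c := by
  simp [polyA, eval_finsetSum]
  ring

lemma prod_cyclotomic_prime_pow_dvd {q : ℕ} (hq : q.Prime) {s : Finset ℕ} {p : ℤ[X]}
    (h : ∀ n ∈ s, cyclotomic (q ^ (n + 1)) ℤ ∣ p) : ∏ n ∈ s, cyclotomic (q ^ (n + 1)) ℤ ∣ p := by
  have hirr (n : ℕ) : Irreducible (cyclotomic (q ^ (n + 1)) ℤ) :=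
    cyclotomic.irreducible (pow_pos hq.pos _)
  refine Finset.prod_dvd_of_isRelPrime (fun m _ n _ hmn => ?_) h
  refine (hirr m).isRelPrime_iff_not_dvd.2 fun hdvd => hmn ?_
  have heq := cyclotomic_injective (R := ℤ) (eq_of_monic_of_associated (cyclotomic.monic _ ℤ)
    (cyclotomic.monic _ ℤ) ((hirr m).associated_of_dvd (hirr n) hdvd))
  exact Nat.succ_injective (Nat.pow_right_injective hq.two_le heq)

lemma prod_cyclotomic_prime_pow_eq_geom_sum {q : ℕ} (hq : q.Prime) (t : ℕ) :
    ∏ s ∈ Finset.range t, cyclotomic (q ^ (s + 1)) ℤ = ∑ i ∈ Finset.range (q ^ t), X ^ i := by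
  have := Fact.mk hq
  have key : (∏ s ∈ Finset.range t, cyclotomic (q ^ (s + 1)) ℤ) * (X - 1) = X ^ q ^ t - 1 := by
    induction t with
    | zero => simp
    | succ t ih =>
      rw [Finset.prod_range_succ, mul_right_comm, ih, mul_comm,
        cyclotomic_prime_pow_mul_X_pow_sub_one]
  refine mul_right_cancel₀ (X_sub_C_ne_zero (1 : ℤ)) ?_
  rw [C_1, key, geom_sum_mul]

lemma eval_one_prod_cyclotomic_prime_pow {q : ℕ} (hq : q.Prime) (s : Finset ℕ) :
    (∏ n ∈ s, cyclotomic (q ^ (n + 1)) ℤ).eval 1 = (q : ℤ) ^ s.card := by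
  have := Fact.mk hq
  simp [eval_prod, eval_one_cyclotomic_prime_pow]

lemma cycloProdPP_prime_pow {q : ℕ} (hq : q.Prime) (t : ℕ) (A : ℤ[X]) :
    cycloProdPP (q ^ t) A =
      ∏ s ∈ (Finset.range t).filter (fun s => cyclotomic (q ^ (s + 1)) ℤ ∣ A),
        cyclotomic (q ^ (s + 1)) ℤ := by
  symm
  refine Finset.prod_bij (fun s _ => q ^ (s + 1)) (fun s hs => ?_) (fun s _ s' _ h => ?_)
    (fun n hn => ?_) fun s _ => rfl
  · rw [Finset.mem_filter, Finset.mem_range] at hs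
    rw [Finset.mem_filter, Nat.mem_divisors]
    exact ⟨⟨pow_dvd_pow _ hs.1, pow_ne_zero _ hq.ne_zero⟩,
      hq.isPrimePow.pow s.succ_ne_zero, hs.2⟩
  · exact Nat.succ_injective (Nat.pow_right_injective hq.two_le h)
  · rw [Finset.mem_filter, Nat.mem_divisors, Nat.dvd_prime_pow hq] at hn
    obtain ⟨⟨⟨m, hm, rfl⟩, -⟩, hpp, hdvd⟩ := hn
    obtain _ | m := m
    · exact absurd hpp (by simpa using not_isPrimePow_one)
    · exact ⟨m, by simpa using ⟨hm, hdvd⟩, rfl⟩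

lemma exists_add_eq_and_eval_one_eq (p : ℕ[X]) {j : ℕ} (hj : j ≤ p.eval 1) :
    ∃ r s : ℕ[X], r + s = p ∧ r.eval 1 = j := by
  induction p using Polynomial.induction_on' generalizing j with
  | add p₁ p₂ ih₁ ih₂ =>
    rw [eval_add] at hj
    obtain ⟨r₁, s₁, rfl, hr₁⟩ := ih₁ (min_le_right j _)
    obtain ⟨r₂, s₂, rfl, hr₂⟩ := ih₂ (j := j - min j (eval 1 (r₁ + s₁))) (by omega)
    exact ⟨r₁ + r₂, s₁ + s₂, add_add_add_comm .., by rw [eval_add, hr₁, hr₂]; omega⟩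
  | monomial n a =>
    have hja : j ≤ a := by simpa using hj
    exact ⟨monomial n j, monomial n (a - j), by rw [← map_add, Nat.add_sub_cancel' hja], by simp⟩

lemma exists_zero_one_poly_dvd {q : ℕ} (hq : q.Prime) (t : ℕ) {S T : Finset ℕ}
    (hST : (∏ s ∈ S, cyclotomic (q ^ (s + 1)) ℤ) * ∏ s ∈ T, cyclotomic (q ^ (s + 1)) ℤ =
      ∑ i ∈ Finset.range (q ^ t), X ^ i) {j : ℕ} (hj : j ≤ q ^ S.card) :
    ∃ f : ZMod (q ^ t) → Bool,
      ∏ s ∈ T, cyclotomic (q ^ (s + 1)) ℤ ∣ maskPoly (q ^ t) (fun n => (f n).toInt) ∧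
      (maskPoly (q ^ t) (fun n => (f n).toInt)).eval 1 = j * (q : ℤ) ^ T.card := by
  set G : Finset ℕ → ℕ[X] := fun U => ∏ s ∈ U, ∑ i ∈ Finset.range q, (X ^ q ^ s) ^ i
  have hG (U) : (G U).map (Nat.castRingHom ℤ) = ∏ s ∈ U, cyclotomic (q ^ (s + 1)) ℤ := by
    simp [G, Polynomial.map_prod, Polynomial.map_sum, cyclotomic_prime_pow_eq_geom_sum hq]
  have hGST : G S * G T = ∑ i ∈ Finset.range (q ^ t), X ^ i := by
    apply map_injective (Nat.castRingHom ℤ) Nat.cast_injective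
    rw [Polynomial.map_mul, hG, hG, hST]
    simp [Polynomial.map_sum]
  obtain ⟨r, s, hrs, hr⟩ := exists_add_eq_and_eval_one_eq (G S) (j := j) (by
    simpa [G, eval_prod, eval_finsetSum] using hj)
  have hcoeff (n) : (r * G T).coeff n ≤ if n < q ^ t then 1 else 0 := by
    have h := congrArg (coeff · n) hGST
    rw [← hrs, add_mul] at h
    simp only [coeff_add, finsetSum_coeff, coeff_X_pow, Finset.sum_ite_eq, Finset.mem_range] at h
    omega
  set V : ℤ[X] := (r * G T).map (Nat.castRingHom ℤ) with hV
  have hdeg : V.natDegree < q ^ t := by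
    refine lt_of_not_ge fun hle => ?_
    have hV0 : V ≠ 0 := fun h0 => by
      rw [h0, natDegree_zero] at hle
      exact (pow_pos hq.pos t).not_ge hle
    have h := hcoeff V.natDegree
    rw [if_neg hle.not_gt, Nat.le_zero] at h
    exact hV0 (leadingCoeff_eq_zero.1 (by rw [leadingCoeff, hV, coeff_map, ← hV, h, map_zero]))
  have hmask : maskPoly (q ^ t) (fun n => (decide (V.coeff n.val = 1)).toInt) = V := by
    conv_rhs => rw [← maskPoly_coeff hdeg]
    congr 1
    funext n
    have h : (r * G T).coeff n.val ≤ 1 := (hcoeff _).trans (by split <;> omega)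
    rw [hV, coeff_map]
    interval_cases (r * G T).coeff n.val <;> simp
  refine ⟨fun n => decide (V.coeff n.val = 1), ?_, ?_⟩
  · rw [hmask, hV, Polynomial.map_mul, hG]
    exact dvd_mul_left _ _
  · rw [hmask, hV, Polynomial.map_mul, hG, eval_mul, eval_one_prod_cyclotomic_prime_pow hq, eval_one_map, hr]
    simp

/-- For `P = q^t` a prime power, the circulant graph `C_P(l_1,...,l_k)` has a perfect
2-colouring with parameters `(b,c)` if and only if `(b+c)/gcd(b,c)` divides `S̃_P(1)`. -/
theorem stmt1 (k : ℕ) (hk : 1 ≤ k) (l : Fin k → ℕ) (b c : ℕ) (hb : 0 < b) (hc : 0 < c)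
    (q t : ℕ) (hq : q.Prime) (ht : 0 < t) :
    (∃ f : ZMod (q ^ t) → Bool, IsPerfectColouring (q ^ t) k l b c f) ↔
      (((b + c) / Nat.gcd b c : ℕ) : ℤ) ∣ (cycloProdPP (q ^ t) (polyA k l b c)).eval 1 := by
  have : NeZero (q ^ t) := ⟨pow_ne_zero _ hq.ne_zero⟩
  set A := polyA k l b c
  set S := (Finset.range t).filter fun s => cyclotomic (q ^ (s + 1)) ℤ ∣ A
  set T := (Finset.range t).filter fun s => ¬ cyclotomic (q ^ (s + 1)) ℤ ∣ A
  have hcard : S.card + T.card = t := by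
    simpa using Finset.card_filter_add_card_filter_not (s := Finset.range t)
      fun s => cyclotomic (q ^ (s + 1)) ℤ ∣ A
  have hprod : (∏ s ∈ S, cyclotomic (q ^ (s + 1)) ℤ) * ∏ s ∈ T, cyclotomic (q ^ (s + 1)) ℤ =
      ∑ i ∈ Finset.range (q ^ t), X ^ i := by
    rw [Finset.prod_filter_mul_prod_filter_not, prod_cyclotomic_prime_pow_eq_geom_sum hq]
  have hS : ∏ s ∈ S, cyclotomic (q ^ (s + 1)) ℤ ∣ A :=
    prod_cyclotomic_prime_pow_dvd hq fun s hs => (Finset.mem_filter.1 hs).2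
  rw [cycloProdPP_prime_pow hq, eval_one_prod_cyclotomic_prime_pow hq]
  obtain ⟨g, b', c', hg, hcop, hb', hc'⟩ := Nat.exists_coprime' (Nat.gcd_pos_of_pos_left c hb)
  have hgcd : (b + c) / b.gcd c = b' + c' := by
    rw [hb', hc', Nat.gcd_mul_right, hcop.gcd_eq_one, one_mul, ← add_mul, Nat.mul_div_cancel _ hg]
  rw [hgcd, ← Nat.cast_pow, Int.natCast_dvd_natCast]
  simp only [isPerfectColouring_iff_dvd]
  constructor
  · rintro ⟨f, hf⟩
    set V := maskPoly (q ^ t) fun n => (f n).toInt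
    have hT : ∏ s ∈ T, cyclotomic (q ^ (s + 1)) ℤ ∣ V := by
      refine prod_cyclotomic_prime_pow_dvd hq fun s hs => ?_
      rw [Finset.mem_filter] at hs
      have hN : cyclotomic (q ^ (s + 1)) ℤ ∣ ∑ i ∈ Finset.range (q ^ t), X ^ i := by
        rw [← prod_cyclotomic_prime_pow_eq_geom_sum hq]
        exact Finset.dvd_prod_of_mem (fun s => cyclotomic (q ^ (s + 1)) ℤ) hs.1
      have hAV : cyclotomic (q ^ (s + 1)) ℤ ∣ A * V := by
        rw [← geom_sum_mul] at hf
        exact (dvd_sub_left (hN.mul_left _)).1 ((hN.mul_right _).trans hf)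
      exact ((cyclotomic.irreducible (pow_pos hq.pos _)).prime.dvd_or_dvd hAV).resolve_left hs.2
    have heval : (b + c : ℤ) * V.eval 1 = c * q ^ t := by
      have h := eval_dvd (x := 1) hf
      simpa [A, eval_one_polyA, eval_finsetSum, sub_eq_zero] using h
    obtain ⟨W, hW⟩ := hT
    have hdvd : ((b + c : ℕ) : ℤ) ∣ (c * q ^ S.card : ℕ) := by
      refine ⟨W.eval 1, ?_⟩
      rw [hW, eval_mul, eval_one_prod_cyclotomic_prime_pow hq, ← hcard, pow_add] at heval
      refine mul_right_cancel₀ (pow_ne_zero T.card (Nat.cast_ne_zero.2 hq.ne_zero)) ?_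
      push_cast
      linear_combination -heval
    rw [Int.natCast_dvd_natCast, hb', hc', ← add_mul, mul_right_comm,
      Nat.mul_dvd_mul_iff_right hg] at hdvd
    refine Nat.Coprime.dvd_of_dvd_mul_left ?_ hdvd
    simpa using hcop
  · rintro ⟨e, he⟩
    obtain ⟨f, hf, hf1⟩ := exists_zero_one_poly_dvd hq t hprod (j := c' * e) (by
      rw [he]; gcongr; omega)
    refine ⟨f, ?_⟩
    set V := maskPoly (q ^ t) fun n => (f n).toInt
    obtain ⟨W, hW⟩ : ∑ i ∈ Finset.range (q ^ t), X ^ i ∣ A * V := hprod ▸ mul_dvd_mul hS hf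
    have hW1 : W.eval 1 = c := by
      have h := congrArg (eval 1) hW
      rw [eval_mul, eval_mul, hf1, eval_one_polyA, ← Nat.cast_add, hb', hc'] at h
      simp only [eval_finsetSum, eval_pow, eval_X, one_pow, Finset.sum_const, Finset.card_range,
        nsmul_eq_mul, mul_one] at h
      rw [← hcard, pow_add, he] at h
      have h0 : ((b' + c') * e * q ^ T.card : ℤ) ≠ 0 := by
        rw [← Nat.cast_add, ← Nat.cast_mul, ← he]
        exact_mod_cast mul_ne_zero (pow_ne_zero _ hq.ne_zero) (pow_ne_zero _ hq.ne_zero)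
      refine mul_left_cancel₀ h0 ?_
      push_cast [hc'] at h ⊢
      linear_combination -h
    rw [hW, mul_comm, ← sub_mul, mul_comm, ← geom_sum_mul, ← C_1 (R := ℤ)]
    refine mul_dvd_mul_left _ (dvd_iff_isRoot.2 ?_)
    simp [hW1]
end

section
/- For all nonnegative integers l_1, l_2, l_3 and for every pair (b,c) ∈ {(5,3), (5,4), (6,4), (6,5)}, the infinite circulant graph C_∞(l_1,l_2,l_3) with 3 distances has no perfect 2-colouring with parameters (b,c). -/
open Polynomial

open scoped Classical

/-- A solution of the homogeneous circulant recurrence vanishing on a window of length twice the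
largest distance vanishes everywhere. -/
theorem eq_zero_of_circulant_recurrence {k : ℕ} {l : Fin k → ℕ} {d : ℤ} {w : ℤ → ℤ}
    (hM : 0 < Finset.univ.sup l)
    (hw : ∀ n, ∑ i, (w (n + l i) + w (n - l i)) + d * w n = 0)
    (h0 : ∀ n : ℤ, 0 ≤ n → n < 2 * (Finset.univ.sup l : ℕ) → w n = 0) (n : ℤ) : w n = 0 := by
  obtain ⟨M, hMdef⟩ : ∃ M, M = Finset.univ.sup l := ⟨_, rfl⟩
  rw [← hMdef] at hM h0
  have hle : ∀ i, l i ≤ M := fun i => hMdef ▸ Finset.le_sup (Finset.mem_univ i)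
  have hne : (Finset.univ : Finset (Fin k)).Nonempty := by
    by_contra h
    rw [Finset.not_nonempty_iff_eq_empty] at h
    simp [h] at hMdef
    omega
  obtain ⟨i₀, -, hi₀⟩ := Finset.exists_mem_eq_sup _ hne l
  have hcard : ((Finset.univ.filter (fun i => l i = M)).card : ℤ) ≠ 0 := by
    have : 0 < (Finset.univ.filter (fun i => l i = M)).card :=
      Finset.card_pos.2 ⟨i₀, by simp [hMdef, hi₀]⟩
    omega
  have key : ∀ t : ℕ, ∀ n : ℤ, -t ≤ n → n < 2 * M + t → w n = 0 := by
    intro t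
    induction t with
    | zero => intro n h1 h2; exact h0 n (by simpa using h1) (by simpa using h2)
    | succ t ih =>
      intro n h1 h2
      push_cast at h1 h2
      by_cases hlo : n < -t
      · have e := hw (n + M)
        rw [ih (n + M) (by omega) (by omega)] at e
        have : ∀ i, w (n + M + l i) + w (n + M - l i) = if l i = M then w n else 0 := by
          intro i
          have := hle i
          rw [ih (n + M + l i) (by omega) (by omega)]
          split_ifs with h
          · rw [h]; simp
          · rw [ih (n + M - l i) (by omega) (by omega)]; simp
        simp only [this] at e
        rw [← Finset.sum_filter, Finset.sum_const, nsmul_eq_mul] at e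
        rw [mul_zero, add_zero] at e
        exact (mul_eq_zero.1 e).resolve_left hcard
      by_cases hhi : 2 * M + t ≤ n
      · have e := hw (n - M)
        rw [ih (n - M) (by omega) (by omega)] at e
        have : ∀ i, w (n - M + l i) + w (n - M - l i) = if l i = M then w n else 0 := by
          intro i
          have := hle i
          rw [ih (n - M - l i) (by omega) (by omega)]
          split_ifs with h
          · rw [h]; simp
          · rw [ih (n - M + l i) (by omega) (by omega)]; simp
        simp only [this] at e
        rw [← Finset.sum_filter, Finset.sum_const, nsmul_eq_mul] at e
        rw [mul_zero, add_zero] at e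
        exact (mul_eq_zero.1 e).resolve_left hcard
      · exact ih n (by omega) (by omega)
  exact key n.natAbs n (by omega) (by omega)

/-- A two-valued solution of a circulant recurrence is periodic. -/
theorem exists_period_of_circulant_recurrence {k : ℕ} {l : Fin k → ℕ} {d c : ℤ} {f : ℤ → Bool}
    (hM : 0 < Finset.univ.sup l)
    (hf : ∀ n, ∑ i, (((f (n + l i)).toNat : ℤ) + (f (n - l i)).toNat) + d * (f n).toNat = c) :
    ∃ P : ℕ, 0 < P ∧ ∀ n, f (n + P) = f n := by
  obtain ⟨s, t, hst, hwin⟩ := Finite.exists_ne_map_eq_of_infinite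
    (fun (s : ℕ) (j : Fin (2 * Finset.univ.sup l)) => f (s + (j : ℕ)))
  wlog hlt : s < t generalizing s t
  · exact this t s hst.symm hwin.symm (by omega)
  have hz := eq_zero_of_circulant_recurrence (l := l) (d := d)
    (w := fun n => ((f (s + n)).toNat : ℤ) - (f (t + n)).toNat) hM
    (by
      intro n
      have e1 := hf (s + n)
      have e2 := hf (t + n)
      simp only [Finset.sum_add_distrib, Finset.sum_sub_distrib, ← add_assoc,
        ← add_sub_assoc] at e1 e2 ⊢
      linear_combination e1 - e2)
    (by
      intro n h0 h1
      have := congrFun hwin ⟨n.toNat, by omega⟩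
      simp only [Int.toNat_of_nonneg h0] at this
      simp [this])
  refine ⟨t - s, by omega, fun n => ?_⟩
  have := hz (n - s)
  rw [Nat.cast_sub hlt.le]
  simp only [add_sub_cancel] at this
  rw [show n + ((t : ℤ) - s) = t + (n - s) by ring]
  revert this
  cases f n <;> cases f (t + (n - s)) <;> simp

theorem sum_range_shift_of_periodic {R : Type*} [AddCommGroup R] {g : ℤ → R} {P : ℕ}
    (hg : ∀ n, g (n + P) = g n) (j : ℤ) :
    ∑ m ∈ Finset.range P, g (m + j) = ∑ m ∈ Finset.range P, g m := by
  have step : ∀ j : ℤ, ∑ m ∈ Finset.range P, g (m + (j + 1)) = ∑ m ∈ Finset.range P, g (m + j) := by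
    intro j
    have h1 := Finset.sum_range_succ (fun m : ℕ => g (m + j)) P
    have h2 := Finset.sum_range_succ' (fun m : ℕ => g (m + j)) P
    rw [h1] at h2
    have : g (P + j) = g ((0 : ℕ) + j) := by rw [add_comm, hg]; simp
    rw [this] at h2
    rw [add_right_cancel h2]
    refine Finset.sum_congr rfl fun m _ => ?_
    push_cast
    congr 1; ring
  induction j using Int.induction_on with
  | zero => simp
  | succ i ih => rw [step, ih]
  | pred i ih => rw [← ih, ← step]; simp

/-- The sum of the coefficients of a polynomial over the exponents in a residue class. -/
noncomputable def residueSum (N : ℕ) (r : ZMod N) : ℤ[X] →ₗ[ℤ] ℤ :=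
  Polynomial.lsum fun a => if (a : ZMod N) = r then LinearMap.id else 0

theorem residueSum_monomial (N : ℕ) (r : ZMod N) (a : ℕ) (z : ℤ) :
    residueSum N r (monomial a z) = if (a : ZMod N) = r then z else 0 := by
  rw [residueSum, Polynomial.lsum_apply, Polynomial.sum_monomial_index _ _ (by simp)]
  split_ifs <;> simp

theorem residueSum_C_mul_X_pow (N : ℕ) (r : ZMod N) (a : ℕ) (z : ℤ) :
    residueSum N r (C z * X ^ a) = if (a : ZMod N) = r then z else 0 := by
  rw [C_mul_X_pow_eq_monomial, residueSum_monomial]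

theorem residueSum_X_pow (N : ℕ) (r : ZMod N) (a : ℕ) :
    residueSum N r (X ^ a) = if (a : ZMod N) = r then 1 else 0 := by
  simpa using residueSum_C_mul_X_pow N r a 1

theorem residueSum_X_pow_mul (N : ℕ) (r : ZMod N) (j : ℕ) (Q : ℤ[X]) :
    residueSum N r (X ^ j * Q) = residueSum N (r - j) Q := by
  induction Q using Polynomial.induction_on' with
  | add p q hp hq => rw [mul_add, map_add, map_add, hp, hq]
  | monomial a z =>
    rw [X_pow_mul_monomial, residueSum_monomial, residueSum_monomial]
    simp [eq_sub_iff_add_eq]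

theorem residueSum_eq_of_cyclotomic_dvd {p : ℕ} [Fact p.Prime] {k : ℕ} {Q : ℤ[X]}
    (hQ : cyclotomic (p ^ (k + 1)) ℤ ∣ Q) (r : ZMod (p ^ (k + 1))) :
    residueSum (p ^ (k + 1)) (r + (p ^ k : ℕ)) Q = residueSum (p ^ (k + 1)) r Q := by
  obtain ⟨R, rfl⟩ := hQ
  have h : X ^ p ^ k * (cyclotomic (p ^ (k + 1)) ℤ * R) - cyclotomic (p ^ (k + 1)) ℤ * R
      = X ^ p ^ (k + 1) * R - R := by
    linear_combination R * cyclotomic_prime_pow_mul_X_pow_sub_one ℤ p k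
  have h2 := congrArg (residueSum (p ^ (k + 1)) (r + (p ^ k : ℕ))) h
  rw [map_sub, map_sub, residueSum_X_pow_mul, residueSum_X_pow_mul, ZMod.natCast_self, sub_zero,
    sub_self, add_sub_cancel_right] at h2
  exact (sub_eq_zero.1 h2).symm

theorem residueSum_polyA (N k : ℕ) (l : Fin k → ℕ) (b c : ℕ) (r : ZMod N) :
    residueSum N ((Finset.univ.sup l : ℕ) + r) (polyA k l b c)
      = (if r = 0 then (b : ℤ) + c - 2 * k else 0)
        + ∑ i, ((if (l i : ZMod N) = r then 1 else 0) + (if (l i : ZMod N) = -r then 1 else 0)) := by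
  rw [polyA, map_add, residueSum_C_mul_X_pow, map_sum]
  congr 1
  · simp
  · refine Finset.sum_congr rfl fun i _ => ?_
    have hi : l i ≤ Finset.univ.sup l := Finset.le_sup (Finset.mem_univ i)
    rw [map_add, residueSum_X_pow, residueSum_X_pow, Nat.cast_sub hi, Nat.cast_add]
    simp only [add_right_inj, sub_eq_add_neg, neg_eq_iff_eq_neg]

/-- The number of neighbours of `0` in the class `r`, with a multiple of the Kronecker delta
at `0`, is constant on the cosets of `p ^ k`. -/
theorem count_eq_of_cyclotomic_dvd_polyA {p : ℕ} [Fact p.Prime] {j k : ℕ} {l : Fin k → ℕ} {b c : ℕ}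
    (h : cyclotomic (p ^ (j + 1)) ℤ ∣ polyA k l b c) (r : ZMod (p ^ (j + 1))) :
    (if r + (p ^ j : ℕ) = 0 then (b : ℤ) + c - 2 * k else 0)
        + ∑ i, ((if (l i : ZMod (p ^ (j + 1))) = r + (p ^ j : ℕ) then 1 else 0)
          + (if (l i : ZMod (p ^ (j + 1))) = -(r + (p ^ j : ℕ)) then 1 else 0))
      = (if r = 0 then (b : ℤ) + c - 2 * k else 0)
        + ∑ i, ((if (l i : ZMod (p ^ (j + 1))) = r then 1 else 0)
          + (if (l i : ZMod (p ^ (j + 1))) = -r then 1 else 0)) := by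
  rw [← residueSum_polyA, ← residueSum_polyA, ← add_assoc, residueSum_eq_of_cyclotomic_dvd h]

/-- A cyclotomic polynomial whose index divides the period divides `polyA` or the mask of a
solution of the recurrence. -/
theorem cyclotomic_dvd_polyA_or_dvd_mask {k : ℕ} {l : Fin k → ℕ} {b c P n : ℕ} {x : ℤ → ℤ}
    (hx : ∀ m, ∑ i, (x (m + l i) + x (m - l i)) + ((b : ℤ) + c - 2 * k) * x m = c)
    (hper : ∀ m, x (m + P) = x m) (hn : 1 < n) (hnP : n ∣ P) :
    cyclotomic n ℤ ∣ polyA k l b c ∨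
      cyclotomic n ℤ ∣ ∑ m ∈ Finset.range P, C (x m) * X ^ m := by
  have hζ := Complex.isPrimitiveRoot_exp n (by omega)
  generalize Complex.exp (2 * Real.pi * Complex.I / n) = ζ at hζ
  have hζ0 : ζ ≠ 0 := hζ.ne_zero (by omega)
  have hζP : ζ ^ P = 1 := (hζ.pow_eq_one_iff_dvd P).2 hnP
  have hdvd : ∀ Q : ℤ[X], aeval ζ Q = 0 → cyclotomic n ℤ ∣ Q := fun Q hQ => by
    rw [cyclotomic_eq_minpoly hζ (by omega)]
    exact minpoly.isIntegrallyClosed_dvd (hζ.isIntegral (by omega)) hQ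
  have hgeom : ∑ m ∈ Finset.range P, ζ ^ m = 0 := by
    have h := geom_sum_mul ζ P
    rw [hζP, sub_self] at h
    exact (mul_eq_zero.1 h).resolve_right (sub_ne_zero.2 (hζ.ne_one hn))
  set B : ℂ := ∑ m ∈ Finset.range P, (x m : ℂ) * ζ ^ m with hB
  have hshift : ∀ j : ℤ, ∑ m ∈ Finset.range P, (x (m + j) : ℂ) * ζ ^ m = ζ ^ (-j) * B := by
    intro j
    have h := sum_range_shift_of_periodic (g := fun m : ℤ => (x m : ℂ) * ζ ^ m) (P := P)
      (fun m => by simp [hper, zpow_add₀ hζ0, hζP]) j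
    simp only [zpow_natCast] at h
    rw [hB, ← h, Finset.mul_sum]
    refine Finset.sum_congr rfl fun m _ => ?_
    rw [zpow_add₀ hζ0, zpow_neg, zpow_natCast]
    field_simp
  have hprod : (∑ i, (ζ ^ (-(l i : ℤ)) + ζ ^ (l i : ℤ)) + ((b : ℂ) + c - 2 * k)) * B = 0 := by
    have h : ∑ m ∈ Finset.range P, ((∑ i, (x (m + l i) + x (m - l i))
        + ((b : ℤ) + c - 2 * k) * x m : ℤ) : ℂ) * ζ ^ m = 0 := by
      simp only [hx]
      rw [← Finset.mul_sum, hgeom, mul_zero]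
    rw [← h]
    push_cast
    simp only [add_mul, Finset.sum_add_distrib, Finset.sum_mul, mul_assoc]
    rw [← Finset.mul_sum, Finset.sum_comm, Finset.sum_comm (s := Finset.range P)]
    congr 2
    · exact Finset.sum_congr rfl fun i _ => (hshift (l i)).symm
    · refine Finset.sum_congr rfl fun i _ => ?_
      simpa [sub_eq_add_neg] using (hshift (-(l i))).symm
  rcases mul_eq_zero.1 hprod with h | h
  · left
    refine hdvd _ ?_
    have e : aeval ζ (polyA k l b c) = ζ ^ (Finset.univ.sup l)
        * (∑ i, (ζ ^ (-(l i : ℤ)) + ζ ^ (l i : ℤ)) + ((b : ℂ) + c - 2 * k)) := by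
      rw [polyA, mul_add, add_comm, Finset.mul_sum]
      simp only [map_add, map_sum, map_mul, map_pow, aeval_X, aeval_C]
      congr 1
      · refine Finset.sum_congr rfl fun i _ => ?_
        have hi : l i ≤ Finset.univ.sup l := Finset.le_sup (Finset.mem_univ i)
        rw [pow_sub₀ _ hζ0 hi, pow_add, zpow_neg, zpow_natCast]
        ring
      · simp [mul_comm]
    rw [e, h, mul_zero]
  · right
    refine hdvd _ ?_
    simpa [hB] using h

/-- If `p ^ v ∣ b + c` and `p ∤ c`, a perfect colouring forces at least `v` cyclotomic
polynomials of `p`-power index to divide `polyA`. -/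
theorem le_card_cyclotomic_dvd_polyA {k : ℕ} {l : Fin k → ℕ} {b c : ℕ} {f : ℤ → Bool}
    (hf : IsPerfectColouringInt k l b c f) {p v : ℕ} [hp : Fact p.Prime] (hpc : ¬ p ∣ c)
    (hv : p ^ v ∣ b + c) :
    ∃ K : Finset ℕ, v ≤ K.card ∧ ∀ j ∈ K, cyclotomic (p ^ (j + 1)) ℤ ∣ polyA k l b c := by
  have hx : ∀ n, ∑ i, (((f (n + l i)).toNat : ℤ) + (f (n - l i)).toNat)
      + ((b : ℤ) + c - 2 * k) * (f n).toNat = c := by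
    intro n
    cases hn : f n with
    | false =>
      have := hf.2 n hn
      rw [← this]
      push_cast
      simp only [Bool.toNat_false, Nat.cast_zero, mul_zero, add_zero]
      refine Finset.sum_congr rfl fun i _ => ?_
      cases f (n + l i) <;> cases f (n - l i) <;> simp
    | true =>
      have := hf.1 n hn
      have e : ∑ i, (((f (n + l i)).toNat : ℤ) + (f (n - l i)).toNat) = 2 * k - b := by
        rw [eq_sub_iff_add_eq, ← this]
        push_cast
        rw [← Finset.sum_add_distrib]
        rw [Finset.sum_congr rfl (g := fun _ => (2 : ℤ))]
        · simp [mul_comm]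
        · intro i _
          cases f (n + l i) <;> cases f (n - l i) <;> simp
      rw [e]
      simp
  rcases Nat.eq_zero_or_pos v with rfl | hv0
  · exact ⟨∅, by simp, by simp⟩
  have hpbc : p ∣ b + c := (dvd_pow_self p hv0.ne').trans hv
  have hM : 0 < Finset.univ.sup l := by
    rw [Nat.pos_iff_ne_zero]
    intro h0
    have hl : ∀ i, l i = 0 := fun i => by
      have : l i ≤ Finset.univ.sup l := Finset.le_sup (Finset.mem_univ i)
      omega
    have h := hx 0
    simp only [hl, Nat.cast_zero, add_zero, sub_zero, Finset.sum_const, Finset.card_univ,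
      Fintype.card_fin, nsmul_eq_mul] at h
    have h' : ((b + c : ℕ) : ℤ) * (f 0).toNat = c := by push_cast; linear_combination h
    exact hpc ((hpbc.trans (Dvd.intro _ rfl)).trans (Dvd.intro_left 1
      (by rw [one_mul]; exact_mod_cast h' : 1 * ((b + c) * (f 0).toNat) = c)))
  obtain ⟨P, hP, hper⟩ := exists_period_of_circulant_recurrence hM hx
  set x : ℤ → ℤ := fun n => (f n).toNat with hxdef
  have hperx : ∀ m, x (m + P) = x m := fun m => by simp [hxdef, hper]
  set B : ℤ[X] := ∑ m ∈ Finset.range P, C (x m) * X ^ m with hB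
  obtain ⟨e, q, hq, hPe⟩ := Nat.exists_eq_pow_mul_and_not_dvd hP.ne' p hp.out.ne_one
  set K := (Finset.range e).filter (fun j => cyclotomic (p ^ (j + 1)) ℤ ∣ polyA k l b c) with hK
  refine ⟨K, ?_, fun j hj => (Finset.mem_filter.1 hj).2⟩
  set K' := (Finset.range e).filter
    (fun j => ¬ cyclotomic (p ^ (j + 1)) ℤ ∣ polyA k l b c) with hK'
  have hcard : K.card + K'.card = e := by
    rw [hK, hK', Finset.card_filter_add_card_filter_not, Finset.card_range]
  have hB1 : ((b + c : ℕ) : ℤ) * B.eval 1 = c * P := by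
    have h : ∑ m ∈ Finset.range P, (∑ i, (x (m + l i) + x (m - l i))
        + ((b : ℤ) + c - 2 * k) * x m) = c * P := by
      rw [Finset.sum_congr rfl fun (m : ℕ) _ => hx m]
      simp [mul_comm]
    rw [← h, Finset.sum_add_distrib, Finset.sum_comm, ← Finset.mul_sum]
    have hs : ∀ i, ∑ m ∈ Finset.range P, (x (m + l i) + x (m - l i)) = 2 * B.eval 1 := by
      intro i
      rw [Finset.sum_add_distrib, sum_range_shift_of_periodic hperx (l i)]
      have := sum_range_shift_of_periodic hperx (-(l i))
      simp only [← sub_eq_add_neg] at this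
      rw [this, hB, eval_finsetSum]
      simp [two_mul]
    have hs0 : ∑ m ∈ Finset.range P, x m = B.eval 1 := by
      rw [hB, eval_finsetSum]; simp
    simp only [hs, hs0]
    simp
    ring
  have hdvd : ∏ j ∈ K', cyclotomic (p ^ (j + 1)) ℤ ∣ B := by
    refine Finset.prod_dvd_of_isRelPrime ?_ ?_
    · intro i _ j _ hij
      have hirr : ∀ j, Irreducible (cyclotomic (p ^ (j + 1)) ℤ) := fun j =>
        cyclotomic.irreducible (pow_pos hp.out.pos _)
      refine (hirr i).isRelPrime_iff_not_dvd.2 fun h => hij ?_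
      have := eq_of_monic_of_associated (cyclotomic.monic _ ℤ) (cyclotomic.monic _ ℤ)
        (associated_of_dvd_dvd h ((hirr i).dvd_symm (hirr j) h))
      have := Nat.pow_right_injective hp.out.two_le (cyclotomic_injective this)
      omega
    · intro j hj
      rw [hK', Finset.mem_filter, Finset.mem_range] at hj
      refine (cyclotomic_dvd_polyA_or_dvd_mask hx hperx
        (Nat.one_lt_pow (by omega) hp.out.one_lt) ?_).resolve_left hj.2
      rw [hPe]
      exact (pow_dvd_pow p hj.1).trans (Dvd.intro _ rfl)
  have hdvd1 : ((p : ℤ) ^ K'.card) ∣ B.eval 1 := by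
    have := eval_dvd (x := 1) hdvd
    rw [eval_prod] at this
    simpa [eval_one_cyclotomic_prime_pow] using this
  have hfin : p ^ (v + K'.card) ∣ p ^ e * (c * q) := by
    have h : ((p ^ v : ℕ) : ℤ) * (p : ℤ) ^ K'.card ∣ c * P :=
      hB1 ▸ mul_dvd_mul (Int.natCast_dvd_natCast.2 hv) hdvd1
    have h' : p ^ v * p ^ K'.card ∣ c * P := by exact_mod_cast h
    rw [pow_add]
    refine h'.trans (dvd_of_eq ?_)
    rw [hPe]; ring
  by_contra hlt
  have h1 : p ^ (e + 1) ∣ p ^ e * (c * q) := (pow_dvd_pow p (by omega)).trans hfin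
  rw [pow_succ] at h1
  have h2 := Nat.dvd_of_mul_dvd_mul_left (pow_pos hp.out.pos e) h1
  exact ((hp.out.dvd_mul).1 h2).elim hpc hq

theorem dvd_and_not_dvd_of_natCast_eq {p : ℕ} [hp : Fact p.Prime] {j n : ℕ}
    (h : (n : ZMod (p ^ (j + 1))) = (p ^ j : ℕ) ∨ (n : ZMod (p ^ (j + 1))) = -(p ^ j : ℕ)) :
    p ^ j ∣ n ∧ ¬ p ^ (j + 1) ∣ n := by
  have hnd : ¬ p ^ (j + 1) ∣ p ^ j := by
    rw [Nat.pow_dvd_pow_iff_le_right hp.out.one_lt]; omega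
  have hjj : p ^ j ∣ p ^ (j + 1) := pow_dvd_pow p (Nat.le_succ j)
  rcases h with h | h
  · rw [ZMod.natCast_eq_natCast_iff] at h
    exact ⟨(h.dvd_iff hjj).2 dvd_rfl, fun hd => hnd ((h.dvd_iff dvd_rfl).1 hd)⟩
  · rw [eq_neg_iff_add_eq_zero, ← Nat.cast_add, ZMod.natCast_eq_zero_iff] at h
    exact ⟨(Nat.dvd_add_left dvd_rfl).1 (hjj.trans h), fun hd => hnd ((Nat.dvd_add_right hd).1 h)⟩

theorem count_eq_count_zero_of_cyclotomic_dvd_polyA {p : ℕ} [Fact p.Prime] {j k : ℕ}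
    {l : Fin k → ℕ} {b c : ℕ} (h : cyclotomic (p ^ (j + 1)) ℤ ∣ polyA k l b c) :
    ∑ i, ((if (l i : ZMod (p ^ (j + 1))) = (p ^ j : ℕ) then (1 : ℤ) else 0)
        + (if (l i : ZMod (p ^ (j + 1))) = -(p ^ j : ℕ) then 1 else 0))
      = b + c - 2 * k + 2 * ∑ i, if p ^ (j + 1) ∣ l i then (1 : ℤ) else 0 := by
  have e := count_eq_of_cyclotomic_dvd_polyA h 0
  have hnd : ¬ p ^ (j + 1) ∣ p ^ j := (dvd_and_not_dvd_of_natCast_eq (Or.inl rfl)).2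
  simp only [zero_add, neg_zero, if_true, ZMod.natCast_eq_zero_iff, if_neg hnd] at e
  rw [e, Finset.sum_add_distrib]
  ring

/-- For odd `p` and `b + c ≥ 3k`, divisibility by a `p`-power cyclotomic polynomial determines the
`p`-adic valuation of every distance. -/
theorem eq_and_valuation_of_cyclotomic_dvd_polyA {p : ℕ} [hp : Fact p.Prime] (hp2 : p ≠ 2)
    {j k : ℕ} {l : Fin k → ℕ} {b c : ℕ} (hbc : 3 * k ≤ b + c)
    (h : cyclotomic (p ^ (j + 1)) ℤ ∣ polyA k l b c) :
    b + c = 3 * k ∧ ∀ i, p ^ j ∣ l i ∧ ¬ p ^ (j + 1) ∣ l i := by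
  have e := count_eq_count_zero_of_cyclotomic_dvd_polyA h
  have hne : ((p ^ j : ℕ) : ZMod (p ^ (j + 1))) ≠ -(p ^ j : ℕ) := by
    rw [Ne, eq_neg_iff_add_eq_zero, ← Nat.cast_add, ZMod.natCast_eq_zero_iff, ← two_mul, pow_succ,
      mul_comm 2]
    intro hd
    have := Nat.dvd_of_mul_dvd_mul_left (pow_pos hp.out.pos j) hd
    exact hp2 ((Nat.prime_dvd_prime_iff_eq hp.out Nat.prime_two).1 this)
  have hle : ∀ i ∈ Finset.univ,
      ((if (l i : ZMod (p ^ (j + 1))) = (p ^ j : ℕ) then (1 : ℤ) else 0)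
        + (if (l i : ZMod (p ^ (j + 1))) = -(p ^ j : ℕ) then 1 else 0)) ≤ 1 := by
    intro i _
    split_ifs with h1 h2
    · exact absurd (h1.symm.trans h2) hne
    all_goals norm_num
  have hz : 0 ≤ ∑ i, if p ^ (j + 1) ∣ l i then (1 : ℤ) else 0 :=
    Finset.sum_nonneg fun i _ => by split_ifs <;> norm_num
  have hsum := Finset.sum_le_sum hle
  have hcard : ∑ _i : Fin k, (1 : ℤ) = k := by simp
  have hbc' : b + c = 3 * k := by omega
  have heq := (Finset.sum_eq_sum_iff_of_le hle).1 (by omega)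
  refine ⟨hbc', fun i => dvd_and_not_dvd_of_natCast_eq ?_⟩
  have := heq i (Finset.mem_univ i)
  by_contra! hcon
  rw [if_neg hcon.1, if_neg hcon.2] at this
  norm_num at this

/-- If `b + c = 2k + 2`, divisibility by `Φ_{2^(j+1)}` relates the numbers of distances divisible by
`2 ^ j` and by `2 ^ (j + 1)`. -/
theorem card_two_pow_dvd_of_cyclotomic_dvd_polyA {j k : ℕ} {l : Fin k → ℕ} {b c : ℕ}
    (hbc : b + c = 2 * k + 2) (h : cyclotomic (2 ^ (j + 1)) ℤ ∣ polyA k l b c) :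
    (Finset.univ.filter fun i => 2 ^ j ∣ l i).card
      = 2 * (Finset.univ.filter fun i => 2 ^ (j + 1) ∣ l i).card + 1 := by
  have e := count_eq_count_zero_of_cyclotomic_dvd_polyA h
  have hneg : -((2 ^ j : ℕ) : ZMod (2 ^ (j + 1))) = (2 ^ j : ℕ) := by
    rw [neg_eq_iff_add_eq_zero, ← Nat.cast_add, ZMod.natCast_eq_zero_iff, pow_succ, mul_two]
  have hiff : ∀ n : ℕ, (n : ZMod (2 ^ (j + 1))) = (2 ^ j : ℕ) ↔ 2 ^ j ∣ n ∧ ¬ 2 ^ (j + 1) ∣ n := by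
    refine fun n => ⟨fun hn => dvd_and_not_dvd_of_natCast_eq (Or.inl hn), ?_⟩
    rintro ⟨⟨q, rfl⟩, hq⟩
    rcases Nat.even_or_odd' q with ⟨t, rfl | rfl⟩
    · exact absurd ⟨t, by ring⟩ hq
    · rw [show 2 ^ j * (2 * t + 1) = 2 ^ (j + 1) * t + 2 ^ j by ring, Nat.cast_add, Nat.cast_mul,
        ZMod.natCast_self, zero_mul, zero_add]
  have hterm : ∀ i, (if (l i : ZMod (2 ^ (j + 1))) = (2 ^ j : ℕ) then (1 : ℤ) else 0)
      = (if 2 ^ j ∣ l i then 1 else 0) - if 2 ^ (j + 1) ∣ l i then 1 else 0 := by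
    intro i
    have : 2 ^ (j + 1) ∣ l i → 2 ^ j ∣ l i := (pow_dvd_pow 2 (Nat.le_succ j)).trans
    simp only [hiff]
    by_cases h1 : 2 ^ j ∣ l i <;> by_cases h2 : 2 ^ (j + 1) ∣ l i <;> simp_all
  simp only [hneg, hterm, Finset.sum_add_distrib, Finset.sum_sub_distrib, Finset.sum_boole] at e
  omega

/-- No infinite circulant graph with 3 distances has a perfect 2-colouring with
parameters `(5,3)`, `(5,4)`, `(6,4)` or `(6,5)`. -/
theorem stmt4 (l : Fin 3 → ℕ) (b c : ℕ)
    (hbc : (b, c) ∈ ({(5, 3), (5, 4), (6, 4), (6, 5)} : Set (ℕ × ℕ))) :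
    ¬ ∃ f : ℤ → Bool, IsPerfectColouringInt 3 l b c f := by
  rintro ⟨f, hf⟩
  have hdvd_le : ∀ {i j : ℕ}, i < j → ∀ p n : ℕ, p ^ j ∣ n → p ^ (i + 1) ∣ n :=
    fun hij p n => (pow_dvd_pow p hij).trans
  simp only [Set.mem_insert_iff, Set.mem_singleton_iff, Prod.mk.injEq] at hbc
  rcases hbc with ⟨rfl, rfl⟩ | ⟨rfl, rfl⟩ | ⟨rfl, rfl⟩ | ⟨rfl, rfl⟩
  · obtain ⟨K, hK, hKdvd⟩ := le_card_cyclotomic_dvd_polyA hf (p := 2) (v := 3)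
      (by norm_num) (by norm_num)
    have hN := fun j hj => card_two_pow_dvd_of_cyclotomic_dvd_polyA (by norm_num) (hKdvd j hj)
    have hmono : ∀ {i j : ℕ}, i < j → (Finset.univ.filter fun t => 2 ^ j ∣ l t).card
        ≤ (Finset.univ.filter fun t => 2 ^ (i + 1) ∣ l t).card := fun hij =>
      Finset.card_le_card (Finset.monotone_filter_right _ fun t _ => hdvd_le hij 2 (l t))
    obtain ⟨T, hTK, hT⟩ := Finset.exists_subset_card_eq hK
    have hmem := fun t => hTK (T.orderEmbOfFin_mem hT t)
    have h01 := hmono ((T.orderEmbOfFin hT).strictMono (show (0 : Fin 3) < 1 by decide))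
    have h12 := hmono ((T.orderEmbOfFin hT).strictMono (show (1 : Fin 3) < 2 by decide))
    have h0 := hN _ (hmem 0)
    have h1 := hN _ (hmem 1)
    have h2 := hN _ (hmem 2)
    have hle := Finset.card_le_univ
      (Finset.univ.filter fun t => 2 ^ (T.orderEmbOfFin hT 0) ∣ l t)
    rw [Fintype.card_fin] at hle
    omega
  · obtain ⟨K, hK, hKdvd⟩ := le_card_cyclotomic_dvd_polyA hf (p := 3) (v := 2)
      (by norm_num) (by norm_num)
    obtain ⟨i, hi, j, hj, hij⟩ := Finset.one_lt_card.1 hK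
    have hv := fun j hj =>
      (eq_and_valuation_of_cyclotomic_dvd_polyA (by norm_num) (by norm_num) (hKdvd j hj)).2 0
    rcases lt_or_gt_of_ne hij with hlt | hlt
    · exact (hv i hi).2 (hdvd_le hlt 3 _ (hv j hj).1)
    · exact (hv j hj).2 (hdvd_le hlt 3 _ (hv i hi).1)
  · have : Fact (Nat.Prime 5) := ⟨by norm_num⟩
    obtain ⟨K, hK, hKdvd⟩ := le_card_cyclotomic_dvd_polyA hf (p := 5) (v := 1)
      (by norm_num) (by norm_num)
    obtain ⟨j, hj⟩ := Finset.card_pos.1 hK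
    have := (eq_and_valuation_of_cyclotomic_dvd_polyA (by norm_num) (by norm_num) (hKdvd j hj)).1
    omega
  · have : Fact (Nat.Prime 11) := ⟨by norm_num⟩
    obtain ⟨K, hK, hKdvd⟩ := le_card_cyclotomic_dvd_polyA hf (p := 11) (v := 1)
      (by norm_num) (by norm_num)
    obtain ⟨j, hj⟩ := Finset.card_pos.1 hK
    have := (eq_and_valuation_of_cyclotomic_dvd_polyA (by norm_num) (by norm_num) (hKdvd j hj)).1
    omega
end

section
/- Let k ≥ 1 and let b, c be positive integers with b + c = q^s for some prime q and positive integer s. Then there exist nonnegative integers l_1,...,l_k such that the infinite circulant graph C_∞(l_1,...,l_k) with k distances has a perfect 2-colouring with parameters (b,c) if and only if b + c ≤ 2k + gcd(b,c). -/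
open Polynomial

open scoped Classical

/-- Perfect colourings as solutions of a single linear recurrence for the indicator of black. -/
lemma isPerfectColouringInt_iff {k : ℕ} {l : Fin k → ℕ} {b c : ℕ} {f : ℤ → Bool} :
    IsPerfectColouringInt k l b c f ↔
      ∀ n : ℤ, ∑ i : Fin k, ((f (n + l i)).toInt + (f (n - l i)).toInt) =
        c + (2 * k - b - c) * (f n).toInt := by
  have hw (n : ℤ) : ((∑ i : Fin k, ((if f (n + l i) = false then 1 else 0)
      + (if f (n - l i) = false then 1 else 0)) : ℕ) : ℤ) =
      2 * k - ∑ i : Fin k, ((f (n + l i)).toInt + (f (n - l i)).toInt) := by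
    have : (2 * k : ℤ) = ∑ i : Fin k, 2 := by simp [mul_comm]
    rw [this, ← Finset.sum_sub_distrib]
    push_cast
    refine Finset.sum_congr rfl fun i _ => ?_
    cases f (n + l i) <;> cases f (n - l i) <;> rfl
  have hB (n : ℤ) : ((∑ i : Fin k, ((if f (n + l i) = true then 1 else 0)
      + (if f (n - l i) = true then 1 else 0)) : ℕ) : ℤ) =
      ∑ i : Fin k, ((f (n + l i)).toInt + (f (n - l i)).toInt) := by
    push_cast
    refine Finset.sum_congr rfl fun i _ => ?_
    cases f (n + l i) <;> cases f (n - l i) <;> rfl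
  refine ⟨fun ⟨h₁, h₂⟩ n => ?_, fun h => ⟨fun n hn => ?_, fun n hn => ?_⟩⟩
  · cases hn : f n
    · rw [← hB, h₂ n hn]; simp
    · have := hw n
      rw [h₁ n hn] at this
      simp only [Bool.toInt_true]; linarith
  · have h₁ := h n
    have h₂ := hw n
    rw [hn, Bool.toInt_true] at h₁
    zify; push_cast at h₂; rw [h₂]; linarith
  · have h₁ := h n
    have h₂ := hB n
    rw [hn, Bool.toInt_false] at h₁
    zify; push_cast at h₂; rw [h₂]; linarith

lemma sum_range_add_of_periodic {R : Type*} [AddCommGroup R] {h : ℤ → R} {P : ℕ}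
    (hP : ∀ n, h (n + P) = h n) (n : ℤ) :
    ∑ a ∈ Finset.range P, h (n + a) = ∑ a ∈ Finset.range P, h a := by
  have step (n : ℤ) :
      ∑ a ∈ Finset.range P, h (n + 1 + a) = ∑ a ∈ Finset.range P, h (n + a) := by
    have h₁ := Finset.sum_range_succ (fun a : ℕ => h (n + a)) P
    rw [Finset.sum_range_succ'] at h₁
    simp only [Nat.cast_add, Nat.cast_one, Nat.cast_zero, add_zero, hP] at h₁
    rw [← add_right_cancel h₁]
    exact Finset.sum_congr rfl fun a _ => by rw [add_assoc, add_comm 1 (a : ℤ)]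
  induction n with
  | zero => simp
  | succ n ih => rw [step, ih]
  | pred n ih => rw [← ih, ← step]; simp

lemma sum_symm_range (h : ℤ → ℤ) (n : ℤ) (r : ℕ) :
    h n + ∑ j ∈ Finset.range r, (h (n + (j + 1)) + h (n - (j + 1))) =
      ∑ j ∈ Finset.range (2 * r + 1), h (n - r + j) := by
  induction r with
  | zero => simp
  | succ r ih =>
    rw [Finset.sum_range_succ, ← add_assoc, ih, show 2 * (r + 1) + 1 = 2 * r + 1 + 1 + 1 by ring,
      Finset.sum_range_succ _ (2 * r + 1 + 1), Finset.sum_range_succ' _ (2 * r + 1)]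
    have : ∀ j : ℕ, n - ((r + 1 : ℕ) : ℤ) + ((j + 1 : ℕ) : ℤ) = n - r + j := by
      intro j; push_cast; ring
    simp only [this]
    push_cast
    ring_nf

lemma sum_odd_symm_range (h : ℤ → ℤ) (n : ℤ) (r : ℕ) :
    ∑ j ∈ Finset.range r, (h (n + (2 * j + 1)) + h (n - (2 * j + 1))) =
      ∑ j ∈ Finset.range (2 * r), h (n - (2 * r - 1) + 2 * j) := by
  induction r with
  | zero => simp
  | succ r ih =>
    rw [Finset.sum_range_succ, ih, show 2 * (r + 1) = 2 * r + 1 + 1 by ring,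
      Finset.sum_range_succ _ (2 * r + 1), Finset.sum_range_succ' _ (2 * r)]
    have : ∀ j : ℕ, n - (2 * ((r + 1 : ℕ) : ℤ) - 1) + 2 * ((j + 1 : ℕ) : ℤ)
        = n - (2 * r - 1) + 2 * j := by
      intro j; push_cast; ring
    simp only [this]
    push_cast
    ring_nf

/-- A colouring is obtained by using each of `r` distances `e` times and padding with loops. -/
lemma exists_colouring_of_sum_eq {k b c e r u : ℕ} {f : ℤ → Bool} (g : ℕ → ℕ)
    (hk : e * r ≤ k) (hu : 2 * (e * r) + u = b + c)
    (h : ∀ n, e * ∑ j ∈ Finset.range r, ((f (n + g j)).toInt + (f (n - g j)).toInt)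
      + u * (f n).toInt = c) :
    ∃ l : Fin k → ℕ, IsPerfectColouringInt k l b c f := by
  refine ⟨fun i => if (i : ℕ) < e * r then g (i % r) else 0,
    isPerfectColouringInt_iff.2 fun n => ?_⟩
  set F : ℕ → ℤ := fun x => (f (n + x)).toInt + (f (n - x)).toInt with hF
  have h₁ : ∀ e : ℕ, ∑ i ∈ Finset.range (e * r), F (g (i % r)) =
      e * ∑ j ∈ Finset.range r, F (g j) := by
    intro e
    induction e with
    | zero => simp
    | succ e ih =>
      rw [Nat.succ_mul, Finset.sum_range_add, ih]
      push_cast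
      rw [add_mul, one_mul]
      congr 1
      refine Finset.sum_congr rfl fun j hj => ?_
      rw [Nat.mul_add_mod', Nat.mod_eq_of_lt (Finset.mem_range.1 hj)]
  have h₂ : ∑ i ∈ Finset.range k, F (if i < e * r then g (i % r) else 0) =
      e * ∑ j ∈ Finset.range r, F (g j) + (k - e * r) * F 0 := by
    obtain ⟨x, rfl⟩ := Nat.exists_eq_add_of_le hk
    rw [Finset.sum_range_add, ← h₁]
    congr 1
    · exact Finset.sum_congr rfl fun i hi => by rw [if_pos (Finset.mem_range.1 hi)]
    · simp
  rw [Finset.sum_range] at h₂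
  have h₃ := h n
  have hF0 : F 0 = 2 * (f n).toInt := by simp [hF, two_mul]
  rw [hF0] at h₂
  refine h₂.trans ?_
  zify at hu
  have h₄ : (e : ℤ) * ∑ j ∈ Finset.range r, F (g j) = c - u * (f n).toInt := by linarith
  rw [h₄, show (u : ℤ) = b + c - 2 * (e * r) by linarith]
  ring

lemma sum_range_toInt_emod_lt {m c : ℕ} (hc : c ≤ m) (n : ℤ) :
    ∑ j ∈ Finset.range m, (decide ((n + j) % (m : ℤ) < c)).toInt = c := by
  have := sum_range_add_of_periodic (P := m) (h := fun x : ℤ => (decide (x % (m : ℤ) < c)).toInt)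
    (by simp) n
  rw [this]
  obtain ⟨x, rfl⟩ := Nat.exists_eq_add_of_le hc
  rw [Finset.sum_range_add]
  have h₁ : ∀ j ∈ Finset.range c,
      (decide (((j : ℕ) : ℤ) % ((c + x : ℕ) : ℤ) < c)).toInt = 1 := by
    intro j hj
    rw [Finset.mem_range] at hj
    rw [Int.emod_eq_of_lt (by omega) (by omega)]
    simp [hj]
  have h₂ : ∀ j ∈ Finset.range x,
      (decide (((c + j : ℕ) : ℤ) % ((c + x : ℕ) : ℤ) < c)).toInt = 0 := by
    intro j hj
    rw [Finset.mem_range] at hj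
    rw [Int.emod_eq_of_lt (by omega) (by omega), decide_eq_false (by omega), Bool.toInt_false]
  rw [Finset.sum_congr rfl h₁, Finset.sum_congr rfl h₂]
  simp

lemma exists_colouring_of_odd {k d m c : ℕ} (hm : Odd m) (hc : c ≤ m)
    (hk : d * m ≤ 2 * k + d) :
    ∃ (l : Fin k → ℕ) (f : ℤ → Bool), IsPerfectColouringInt k l (d * (m - c)) (d * c) f := by
  obtain ⟨r, rfl⟩ := hm
  obtain ⟨l, hl⟩ := exists_colouring_of_sum_eq (k := k) (e := d) (r := r) (u := d)
    (b := d * (2 * r + 1 - c)) (c := d * c)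
    (f := fun n => decide (n % ((2 * r + 1 : ℕ) : ℤ) < c)) (fun j => j + 1)
    (by nlinarith) (by rw [← mul_add, Nat.sub_add_cancel hc]; ring) fun n => by
      have := sum_symm_range (fun n => (decide (n % ((2 * r + 1 : ℕ) : ℤ) < c)).toInt) n r
      rw [sum_range_toInt_emod_lt hc] at this
      push_cast at this ⊢
      linear_combination (d : ℤ) * this
  exact ⟨l, _, hl⟩

lemma exists_colouring_of_even {k d m c : ℕ} (hd : Even d) (hm : 0 < m) (hc : c ≤ m)
    (hk : d * m ≤ 2 * k + d) :
    ∃ (l : Fin k → ℕ) (f : ℤ → Bool), IsPerfectColouringInt k l (d * (m - c)) (d * c) f := by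
  obtain ⟨e, rfl⟩ := hd
  obtain ⟨r, rfl⟩ := Nat.exists_eq_succ_of_ne_zero hm.ne'
  obtain ⟨l, hl⟩ := exists_colouring_of_sum_eq (k := k) (e := e) (r := r) (u := e + e)
    (b := (e + e) * (r + 1 - c)) (c := (e + e) * c)
    (f := fun n => decide (n % ((r + 1 : ℕ) : ℤ) < c)) (fun j => j + 1)
    (by simp only [Nat.succ_eq_add_one] at hk; nlinarith)
    (by rw [← mul_add, Nat.sub_add_cancel hc, Nat.succ_eq_add_one]; ring) fun n => by
      have h₁ := sum_symm_range (fun n => (decide (n % ((r + 1 : ℕ) : ℤ) < c)).toInt) n r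
      have h₂ := Finset.sum_range_succ
        (fun j : ℕ => (decide ((n - r + j) % ((r + 1 : ℕ) : ℤ) < c)).toInt) (2 * r + 1)
      have h₃ : n - r + ((2 * r + 1 : ℕ) : ℤ) = n + ((r + 1 : ℕ) : ℤ) := by push_cast; ring
      rw [← h₁, show 2 * r + 1 + 1 = (r + 1) + (r + 1) by ring, Finset.sum_range_add,
        sum_range_toInt_emod_lt hc, h₃, Int.add_emod_right] at h₂
      have h₄ := sum_range_toInt_emod_lt hc (n - r + ((r + 1 : ℕ) : ℤ))
      simp only [add_assoc] at h₄
      simp only [Nat.cast_add (r + 1), h₄] at h₂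
      push_cast at h₂ ⊢
      linear_combination -(e : ℤ) * h₂
  exact ⟨l, _, hl⟩

lemma exists_colouring_of_even_of_le {k m c : ℕ} (hm : Even m) (hc : c ≤ m) (hk : m ≤ 2 * k) :
    ∃ (l : Fin k → ℕ) (f : ℤ → Bool), IsPerfectColouringInt k l (m - c) c f := by
  obtain ⟨r, rfl⟩ := hm
  obtain ⟨l, hl⟩ := exists_colouring_of_sum_eq (k := k) (e := 1) (r := r) (u := 0)
    (b := r + r - c) (c := c)
    (f := fun n => decide ((n / 2) % ((2 * r : ℕ) : ℤ) < c)) (fun j => 2 * j + 1)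
    (by omega) (by omega) fun n => by
      have h₁ := sum_odd_symm_range (fun n => (decide ((n / 2) % ((2 * r : ℕ) : ℤ) < c)).toInt) n r
      have h₂ := sum_range_toInt_emod_lt (c := c) (m := 2 * r) (by omega)
        ((n - (2 * r - 1)) / 2)
      have h₃ : ∀ j : ℕ, (n - (2 * r - 1) + 2 * (j : ℤ)) / 2 = (n - (2 * r - 1)) / 2 + j := by
        intro j; omega
      simp only [h₃] at h₁
      rw [h₂] at h₁
      push_cast at h₁ ⊢
      rw [h₁]; ring
  exact ⟨l, _, hl⟩

lemma exists_colouring_of_le {k b c q s : ℕ} (hb : 0 < b) (hq : q.Prime)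
    (hbc : b + c = q ^ s) (h : b + c ≤ 2 * k + Nat.gcd b c) :
    ∃ (l : Fin k → ℕ) (f : ℤ → Bool), IsPerfectColouringInt k l b c f := by
  have hd : 0 < Nat.gcd b c := Nat.gcd_pos_of_pos_left _ hb
  obtain ⟨b', hb'⟩ := Nat.gcd_dvd_left b c
  obtain ⟨c', hc'⟩ := Nat.gcd_dvd_right b c
  set d := Nat.gcd b c
  have hdm : d * (b' + c') = b + c := by rw [mul_add, ← hb', ← hc']
  have hb0 : 0 < b' := Nat.pos_of_mul_pos_left (hb' ▸ hb)
  rw [← hdm] at h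
  rcases Nat.even_or_odd (b' + c') with hm | hm
  · rcases Nat.even_or_odd d with hde | hdo
    · simpa [← hb', ← hc'] using
        exists_colouring_of_even hde (by omega) (Nat.le_add_left c' b') h
    · obtain rfl : q = 2 := by
        have : 2 ∣ q ^ s := hbc ▸ hdm ▸ hm.two_dvd.mul_left d
        exact ((Nat.prime_dvd_prime_iff_eq Nat.prime_two hq).1
          (Nat.prime_two.dvd_of_dvd_pow this)).symm
      have hd1 : d = 1 := by
        obtain ⟨t, -, ht⟩ := (Nat.dvd_prime_pow Nat.prime_two).1 (hbc ▸ hdm ▸ Dvd.intro _ rfl)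
        rcases t with _ | t
        · simpa using ht
        · rw [ht, pow_succ] at hdo
          exact absurd hdo (by simp)
      rw [hd1, one_mul] at hb' hc'
      subst hb' hc'
      rw [hd1] at h
      obtain ⟨x, hx⟩ := hm
      simpa using exists_colouring_of_even_of_le (k := k) (c := c) ⟨x, hx⟩ (by omega) (by omega)
  · simpa [← hb', ← hc'] using exists_colouring_of_odd hm (Nat.le_add_left c' b') h

lemma eq_of_window_eq {k L : ℕ} {l : Fin k → ℕ} {x y : ℤ} {f : ℤ → ℤ} (hl : ∀ i, l i ≤ L)
    (hL : ∃ i, l i = L) (hL0 : 0 < L)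
    (h : ∀ n, ∑ i : Fin k, (f (n + l i) + f (n - l i)) = x + y * f n) {n₁ n₂ : ℤ}
    (hw : ∀ j : ℕ, j < 2 * L → f (n₁ + j) = f (n₂ + j)) (j : ℕ) : f (n₁ + j) = f (n₂ + j) := by
  induction j using Nat.strong_induction_on with
  | _ j ih =>
    by_cases hj : j < 2 * L
    · exact hw j hj
    · have key (i : ℤ) (h₀ : 0 ≤ i) (h₁ : i < j) : f (n₁ + i) = f (n₂ + i) := by
        lift i to ℕ using h₀
        exact ih i (by exact_mod_cast h₁)
      have e₁ := h (n₁ + (j - L : ℤ))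
      have e₂ := h (n₂ + (j - L : ℤ))
      rw [key (j - L) (by omega) (by omega), ← e₂, ← sub_eq_zero,
        ← Finset.sum_sub_distrib] at e₁
      have e₃ : ∀ i ∈ Finset.univ, (f (n₁ + (j - L : ℤ) + l i) + f (n₁ + (j - L : ℤ) - l i)) -
          (f (n₂ + (j - L : ℤ) + l i) + f (n₂ + (j - L : ℤ) - l i)) =
          if l i = L then f (n₁ + j) - f (n₂ + j) else 0 := by
        intro i _
        have hi := hl i
        have h₁ := key (j - L - l i) (by omega) (by omega)
        simp only [add_sub_assoc, add_assoc]
        rw [h₁]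
        split_ifs with hiL
        · rw [hiL, sub_add_cancel]; ring
        · rw [key (j - L + l i) (by omega) (by omega)]; ring
      rw [Finset.sum_congr rfl e₃, ← Finset.sum_filter, Finset.sum_const, nsmul_eq_mul,
        mul_eq_zero] at e₁
      rcases e₁ with e₁ | e₁
      · obtain ⟨i, hi⟩ := hL
        have : 0 < (Finset.univ.filter fun i => l i = L).card :=
          Finset.card_pos.2 ⟨i, by simp [hi]⟩
        omega
      · exact sub_eq_zero.1 e₁

/-- The factorial of the number of windows of length `2 * L` is a period, since two of any
`2 ^ (2 * L) + 1` consecutive windows coincide. -/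
lemma exists_period_of_recurrence {k L : ℕ} {l : Fin k → ℕ} {x y : ℤ} {f : ℤ → Bool}
    (hl : ∀ i, l i ≤ L) (hL : ∃ i, l i = L) (hL0 : 0 < L)
    (h : ∀ n, ∑ i : Fin k, ((f (n + l i)).toInt + (f (n - l i)).toInt) = x + y * (f n).toInt) :
    ∃ P : ℕ, 0 < P ∧ ∀ n, f (n + P) = f n := by
  set N := Fintype.card (Fin (2 * L) → Bool) with hN
  refine ⟨N.factorial, N.factorial_pos, fun n => ?_⟩
  obtain ⟨a, a', haa, hw⟩ := Fintype.exists_ne_map_eq_of_card_lt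
    (fun (a : Fin (N + 1)) (j : Fin (2 * L)) => f (n - N + a + j)) (by simp [hN])
  wlog hlt : a < a' generalizing a a'
  · exact this a' a haa.symm hw.symm (lt_of_le_of_ne (not_lt.1 hlt) haa.symm)
  have hper (j : ℕ) : f (n - N + a + j) = f (n - N + a' + j) := by
    have := eq_of_window_eq (f := fun n => (f n).toInt) hl hL hL0 h
      (n₁ := n - N + a) (n₂ := n - N + a')
      (fun j hj => congrArg Bool.toInt (congrFun hw ⟨j, hj⟩)) j
    revert this
    cases f (n - N + a + j) <;> cases f (n - N + a' + j) <;> simp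
  have ha := a'.is_lt
  have hlt' : (a : ℕ) < a' := hlt
  obtain ⟨p, hp⟩ := Nat.exists_eq_add_of_lt hlt'
  have hstep (j : ℕ) : f (n + j + (p + 1 : ℕ)) = f (n + j) := by
    have := hper (N - a + j)
    rw [show n - N + a + ((N - a + j : ℕ) : ℤ) = n + j by omega,
      show n - N + a' + ((N - a + j : ℕ) : ℤ) = n + j + (p + 1 : ℕ) by omega] at this
    exact this.symm
  have hmul (t : ℕ) : f (n + ((p + 1) * t : ℕ)) = f n := by
    induction t with
    | zero => simp
    | succ t ih =>
      rw [← ih, ← hstep ((p + 1) * t)]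
      congr 1
      push_cast
      ring
  obtain ⟨t, ht⟩ := Nat.dvd_factorial (Nat.succ_pos p) (show p + 1 ≤ N by omega)
  rw [ht]
  exact hmul t

lemma IsPerfectColouringInt.exists_period {k : ℕ} {l : Fin k → ℕ} {b c : ℕ} {f : ℤ → Bool}
    (hb : 0 < b) (hc : 0 < c) (hf : IsPerfectColouringInt k l b c f) :
    ∃ P : ℕ, 0 < P ∧ ∀ n, f (n + P) = f n := by
  have hL0 : 0 < Finset.univ.sup l := by
    by_contra h
    have hl : ∀ i, l i = 0 := fun i =>
      Nat.le_zero.1 ((Finset.le_sup (Finset.mem_univ i)).trans (not_lt.1 h))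
    cases h0 : f 0
    · have := hf.2 0 h0
      simp [hl, h0] at this
      omega
    · have := hf.1 0 h0
      simp [hl, h0] at this
      omega
  have hne : (Finset.univ : Finset (Fin k)).Nonempty := by
    by_contra h
    rw [Finset.not_nonempty_iff_eq_empty.1 h] at hL0
    simp at hL0
  obtain ⟨i, -, hi⟩ := Finset.exists_mem_eq_sup _ hne l
  exact exists_period_of_recurrence (fun i => Finset.le_sup (Finset.mem_univ i)) ⟨i, hi.symm⟩ hL0
    (isPerfectColouringInt_iff.1 hf)

/-- The multitiling identity `A * F = c * x ^ M * (1 + ⋯ + x ^ (P - 1))` modulo `x ^ P - 1`,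
evaluated at a `P`-th root of unity. -/
lemma aeval_polyA_mul_sum {k : ℕ} {l : Fin k → ℕ} {b c P : ℕ} {f : ℤ → Bool}
    (hf : IsPerfectColouringInt k l b c f) (hP : ∀ n, f (n + P) = f n) {ζ : ℂ} (h0 : ζ ≠ 0)
    (hζ : ζ ^ P = 1) :
    aeval ζ (polyA k l b c) * ∑ a ∈ Finset.range P, ((f a).toInt : ℂ) * ζ ^ a =
      c * ζ ^ Finset.univ.sup l * ∑ a ∈ Finset.range P, ζ ^ a := by
  set M := Finset.univ.sup l
  set χ : ℤ → ℂ := fun n => ((f n).toInt : ℂ) with hχ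
  set F := ∑ a ∈ Finset.range P, χ a * ζ ^ a
  have hχP (n : ℤ) : χ (n + P) = χ n := by simp only [hχ, hP]
  have hshift (t : ℤ) : ζ ^ t * F = ∑ a ∈ Finset.range P, χ (a - t) * ζ ^ a := by
    have := sum_range_add_of_periodic (P := P) (h := fun n : ℤ => χ n * ζ ^ (n + t))
      (fun n => by
        rw [hχP, add_right_comm, zpow_add₀ h0 _ (P : ℤ), zpow_natCast, hζ, mul_one]) (-t)
    rw [Finset.mul_sum]
    calc _ = ∑ a ∈ Finset.range P, χ a * ζ ^ ((a : ℤ) + t) :=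
          Finset.sum_congr rfl fun a _ => by rw [zpow_add₀ h0, zpow_natCast]; ring
      _ = _ := by
          rw [← this]
          refine Finset.sum_congr rfl fun a _ => ?_
          rw [neg_add_eq_sub, sub_add_cancel, zpow_natCast]
  have hA : aeval ζ (polyA k l b c) = ζ ^ M * ((b + c - 2 * k) * ζ ^ (0 : ℤ) +
      ∑ i : Fin k, (ζ ^ (l i : ℤ) + ζ ^ (-(l i : ℤ)))) := by
    simp only [polyA, map_add, map_mul, map_sum, map_pow, aeval_X, aeval_C]
    rw [mul_add, Finset.mul_sum]
    congr 1
    · simp [M, mul_comm]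
    · refine Finset.sum_congr rfl fun i _ => ?_
      have hi : l i ≤ M := Finset.le_sup (Finset.mem_univ i)
      rw [pow_add, pow_sub₀ ζ h0 hi, zpow_neg, zpow_natCast]
      ring
  rw [hA, mul_assoc, add_mul, Finset.sum_mul, mul_assoc, hshift]
  simp only [add_mul, hshift, sub_zero, sub_neg_eq_add]
  rw [Finset.mul_sum]
  simp only [← Finset.sum_add_distrib]
  rw [Finset.sum_comm, ← Finset.sum_add_distrib, mul_comm (c : ℂ), mul_assoc,
    Finset.mul_sum _ _ (c : ℂ)]
  congr 1
  refine Finset.sum_congr rfl fun a _ => ?_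
  simp only [← add_mul]
  rw [← Finset.sum_mul]
  have h₁ := isPerfectColouringInt_iff.1 hf a
  have h₂ : ∑ i : Fin k, (χ (a - l i) + χ (a + l i)) = c + (2 * k - b - c) * χ a := by
    simp only [hχ, add_comm (((f (a - l _)).toInt : ℤ) : ℂ)]
    exact_mod_cast h₁
  rw [h₂]
  ring

/-- The sum of the coefficients of a polynomial in the residue class of `M` modulo `Q`. -/
noncomputable def residueMass (Q M : ℕ) (A : ℤ[X]) : ℤ :=
  A.sum fun n a => if n ≡ M [MOD Q] then a else 0

lemma residueMass_add (Q M : ℕ) (A B : ℤ[X]) :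
    residueMass Q M (A + B) = residueMass Q M A + residueMass Q M B :=
  sum_add_index _ _ _ (by simp) (fun n a b => by split_ifs <;> simp)

lemma residueMass_monomial (Q M n : ℕ) (a : ℤ) :
    residueMass Q M (monomial n a) = if n ≡ M [MOD Q] then a else 0 :=
  sum_monomial_index _ _ (by simp)

lemma residueMass_sum {ι : Type*} (Q M : ℕ) (s : Finset ι) (A : ι → ℤ[X]) :
    residueMass Q M (∑ i ∈ s, A i) = ∑ i ∈ s, residueMass Q M (A i) :=
  map_sum (AddMonoidHom.mk' (residueMass Q M) (residueMass_add Q M)) A s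

lemma residueMass_one (M : ℕ) (A : ℤ[X]) : residueMass 1 M A = A.eval 1 := by
  simp [residueMass, Nat.modEq_one, eval_eq_sum]

lemma coeff_le_residueMass {A : ℤ[X]} (hA : ∀ n, 0 ≤ A.coeff n) (Q M : ℕ) :
    A.coeff M ≤ residueMass Q M A := by
  have hnn : ∀ n ∈ A.support, 0 ≤ if n ≡ M [MOD Q] then A.coeff n else 0 := fun n _ => by
    split_ifs <;> simp [hA]
  by_cases hM : M ∈ A.support
  · exact le_of_eq_of_le (by simp [Nat.ModEq.refl])
      (Finset.single_le_sum (f := fun n => if n ≡ M [MOD Q] then A.coeff n else 0) hnn hM)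
  · rw [notMem_support_iff.1 hM]
    exact Finset.sum_nonneg hnn

lemma residueMass_le_of_dvd {A : ℤ[X]} (hA : ∀ n, 0 ≤ A.coeff n) {Q Q' : ℕ} (h : Q ∣ Q')
    (M : ℕ) : residueMass Q' M A ≤ residueMass Q M A := by
  refine Finset.sum_le_sum fun n _ => ?_
  dsimp only
  by_cases hn : n ≡ M [MOD Q']
  · rw [if_pos hn, if_pos (hn.of_dvd h)]
  · rw [if_neg hn]
    split_ifs <;> simp [hA]

lemma sum_range_ite_modEq {q Q : ℕ} (hq : 0 < q) (hQ : 0 < Q) (e M : ℕ) (a : ℤ) :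
    ∑ i ∈ Finset.range q, (if e + Q * i ≡ M [MOD Q * q] then a else 0) =
      if e ≡ M [MOD Q] then a else 0 := by
  split_ifs with he
  · obtain ⟨u, hu⟩ := Nat.modEq_iff_dvd.1 he
    have hq' : (q : ℤ) ≠ 0 := by positivity
    have hiff (i : ℕ) : e + Q * i ≡ M [MOD Q * q] ↔ (q : ℤ) ∣ u - i := by
      rw [Nat.modEq_iff_dvd]
      push_cast
      rw [show (M : ℤ) - (e + Q * i) = Q * (u - i) by linear_combination hu]
      exact mul_dvd_mul_iff_left (by positivity)
    have h0 := Int.emod_nonneg u hq'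
    have h1 := Int.emod_lt_of_pos u (show (0 : ℤ) < q by positivity)
    rw [Finset.sum_eq_single (u % q).toNat]
    · rw [if_pos]
      rw [hiff, Int.toNat_of_nonneg h0]
      exact Int.dvd_self_sub_emod
    · intro i hi hne
      rw [if_neg]
      rw [hiff]
      intro hd
      refine hne ?_
      have h2 : u % q = (i : ℤ) % q := Int.emod_eq_emod_iff_emod_sub_eq_zero.2
        (Int.emod_eq_zero_of_dvd hd)
      rw [Int.emod_eq_of_lt (a := (i : ℤ)) (by omega)
        (by exact_mod_cast Finset.mem_range.1 hi)] at h2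
      omega
    · intro h
      exact absurd (Finset.mem_range.2 (by omega)) h
  · refine Finset.sum_eq_zero fun i _ => if_neg fun h => he ?_
    have := h.of_dvd (Dvd.intro q rfl)
    simpa [Nat.ModEq] using this

/-- Divisibility by `Φ_{q ^ (j + 1)}` equidistributes each residue class modulo `q ^ j` among
its `q` subclasses modulo `q ^ (j + 1)`. -/
lemma residueMass_of_cyclotomic_dvd {q j : ℕ} (hq : q.Prime) {A : ℤ[X]}
    (h : cyclotomic (q ^ (j + 1)) ℤ ∣ A) (M : ℕ) :
    residueMass (q ^ j) M A = q * residueMass (q ^ (j + 1)) M A := by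
  obtain ⟨B, rfl⟩ := h
  induction B using Polynomial.induction_on' with
  | add p r hp hr => rw [mul_add, residueMass_add, residueMass_add, hp, hr, mul_add]
  | monomial e a =>
    have hmul : cyclotomic (q ^ (j + 1)) ℤ * monomial e a =
        ∑ i ∈ Finset.range q, monomial (e + q ^ j * i) a := by
      rw [cyclotomic_prime_pow_eq_geom_sum hq, Finset.sum_mul]
      refine Finset.sum_congr rfl fun i _ => ?_
      rw [← pow_mul, X_pow_mul, monomial_mul_X_pow]
    rw [hmul, residueMass_sum, residueMass_sum]
    simp only [residueMass_monomial, pow_succ]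
    rw [sum_range_ite_modEq hq.pos (pow_pos hq.pos j)]
    have (i : ℕ) : e + q ^ j * i ≡ M [MOD q ^ j] ↔ e ≡ M [MOD q ^ j] := by simp [Nat.ModEq]
    simp [this]

lemma pow_card_mul_coeff_le_eval_one {q : ℕ} (hq : q.Prime) {A : ℤ[X]}
    (hA : ∀ n, 0 ≤ A.coeff n) (M m : ℕ) :
    (q : ℤ) ^ ((Finset.range m).filter fun j => cyclotomic (q ^ (j + 1)) ℤ ∣ A).card * A.coeff M
      ≤ A.eval 1 := by
  refine le_trans (mul_le_mul_of_nonneg_left (coeff_le_residueMass hA (q ^ m) M) (by positivity)) ?_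
  induction m with
  | zero => simp [residueMass_one]
  | succ m ih =>
    rw [Finset.range_add_one, Finset.filter_insert]
    split_ifs with h
    · rw [Finset.card_insert_of_notMem (by simp), pow_succ, mul_assoc,
        ← residueMass_of_cyclotomic_dvd hq h]
      exact ih
    · exact le_trans (mul_le_mul_of_nonneg_left
        (residueMass_le_of_dvd hA (pow_dvd_pow q m.le_succ) M) (by positivity)) ih

lemma pow_card_dvd_eval_one {q : ℕ} (hq : q.Prime) {B : ℤ[X]} (T : Finset ℕ)
    (hT : ∀ j ∈ T, cyclotomic (q ^ (j + 1)) ℤ ∣ B) : (q : ℤ) ^ T.card ∣ B.eval 1 := by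
  have := Fact.mk hq
  have hirr (j : ℕ) : Irreducible (cyclotomic (q ^ (j + 1)) ℤ) :=
    cyclotomic.irreducible (pow_pos hq.pos _)
  have h : ∏ j ∈ T, cyclotomic (q ^ (j + 1)) ℤ ∣ B := by
    refine Finset.prod_dvd_of_isRelPrime (fun i _ j _ hij => ?_) hT
    refine (hirr i).isRelPrime_iff_not_dvd.2 fun hdvd => hij ?_
    have heq := cyclotomic_injective (eq_of_monic_of_associated (cyclotomic.monic _ ℤ)
      (cyclotomic.monic _ ℤ) ((hirr i).associated_of_dvd (hirr j) hdvd))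
    exact Nat.succ_injective (Nat.pow_right_injective hq.two_le heq)
  have h₂ := eval_dvd (x := 1) h
  rw [eval_prod] at h₂
  simpa [eval_one_cyclotomic_prime_pow] using h₂

lemma polyA_coeff_nonneg {k b c : ℕ} (l : Fin k → ℕ) (h : 2 * k ≤ b + c) (n : ℕ) :
    0 ≤ (polyA k l b c).coeff n := by
  simp only [polyA, coeff_add, coeff_C_mul, coeff_X_pow, finsetSum_coeff]
  refine add_nonneg (mul_nonneg (by omega) (by split_ifs <;> simp))
    (Finset.sum_nonneg fun i _ => add_nonneg ?_ ?_) <;> split_ifs <;> simp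

lemma le_polyA_coeff_sup (k b c : ℕ) (l : Fin k → ℕ) :
    (b : ℤ) + c - 2 * k ≤ (polyA k l b c).coeff (Finset.univ.sup l) := by
  simp only [polyA, coeff_add, coeff_C_mul, coeff_X_pow, finsetSum_coeff, if_true, mul_one]
  refine le_add_of_nonneg_right (Finset.sum_nonneg fun i _ => add_nonneg ?_ ?_) <;>
    split_ifs <;> simp

lemma IsPerfectColouringInt.le_of_prime_pow {k : ℕ} {l : Fin k → ℕ} {b c : ℕ} {f : ℤ → Bool}
    (hf : IsPerfectColouringInt k l b c f) (hb : 0 < b) (hc : 0 < c) {q s : ℕ} (hq : q.Prime)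
    (hbc : b + c = q ^ s) : b + c ≤ 2 * k + Nat.gcd b c := by
  rcases Nat.lt_or_ge (b + c) (2 * k) with hk | hk
  · omega
  obtain ⟨P, hP0, hP⟩ := hf.exists_period hb hc
  set A := polyA k l b c with hA
  set B : ℤ[X] := ∑ a ∈ Finset.range P, C (f a).toInt * X ^ a with hB
  have hBζ (ζ : ℂ) : aeval ζ B = ∑ a ∈ Finset.range P, ((f a).toInt : ℂ) * ζ ^ a := by
    simp [hB, map_sum]
  have heval : (q : ℤ) ^ s * B.eval 1 = c * P := by
    have h := aeval_polyA_mul_sum hf hP one_ne_zero (one_pow P)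
    rw [← hBζ, ← map_one (algebraMap ℤ ℂ), aeval_algebraMap_apply, aeval_algebraMap_apply,
      ← map_mul, coe_aeval_eq_eval, eval_one_polyA] at h
    have hbc' : (b : ℤ) + c = q ^ s := by exact_mod_cast hbc
    rw [hbc'] at h
    simp only [map_one, one_pow, mul_one, Finset.sum_const, Finset.card_range] at h
    apply (algebraMap ℤ ℂ).injective_int
    simpa using h
  have hdvd {n : ℕ} (hn : n ∣ P) (hn1 : 1 < n) : cyclotomic n ℤ ∣ A ∨ cyclotomic n ℤ ∣ B := by
    have hn0 : n ≠ 0 := by omega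
    have hζ := Complex.isPrimitiveRoot_exp n hn0
    set ζ := Complex.exp (2 * Real.pi * Complex.I / n)
    refine (cyclotomic.irreducible (by omega)).prime.dvd_or_dvd ?_
    rw [cyclotomic_eq_minpoly hζ (by omega)]
    refine minpoly.isIntegrallyClosed_dvd (hζ.isIntegral (by omega)) ?_
    have hP1 : ζ ^ P = 1 := (hζ.pow_eq_one_iff_dvd P).2 hn
    have hgeom : ∑ a ∈ Finset.range P, ζ ^ a = 0 := by
      have := geom_sum_mul ζ P
      rw [hP1, sub_self] at this
      exact (mul_eq_zero.1 this).resolve_right (sub_ne_zero.2 (hζ.ne_one hn1))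
    rw [map_mul, hBζ, aeval_polyA_mul_sum hf hP (hζ.ne_zero hn0) hP1, hgeom, mul_zero]
  obtain ⟨m, P', hP', rfl⟩ := Nat.exists_eq_pow_mul_and_not_dvd hP0.ne' q hq.ne_one
  set S := (Finset.range m).filter fun j => cyclotomic (q ^ (j + 1)) ℤ ∣ A with hS
  set T := (Finset.range m).filter fun j => ¬ cyclotomic (q ^ (j + 1)) ℤ ∣ A with hT
  have hST : S.card + T.card = m := by
    rw [Finset.card_filter_add_card_filter_not, Finset.card_range]
  have hTB := pow_card_dvd_eval_one hq (B := B) T fun j hj => by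
    rw [hT, Finset.mem_filter, Finset.mem_range] at hj
    exact (hdvd ((pow_dvd_pow q hj.1).mul_right P')
      (Nat.one_lt_pow j.succ_ne_zero hq.one_lt)).resolve_left hj.2
  have h₁ : q ^ s ∣ c * q ^ S.card := by
    have h : q ^ s * q ^ T.card ∣ c * (q ^ m * P') := by
      zify
      push_cast at heval
      rw [← heval]
      exact mul_dvd_mul_left _ hTB
    rw [← hST, pow_add, show c * (q ^ S.card * q ^ T.card * P') =
      c * q ^ S.card * P' * q ^ T.card by ring] at h
    exact (((hq.coprime_iff_not_dvd.2 hP').pow_left s).dvd_of_dvd_mul_right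
      (Nat.dvd_of_mul_dvd_mul_right (pow_pos hq.pos _) h))
  have h₂ : q ^ s ≤ Nat.gcd b c * q ^ S.card := by
    refine Nat.le_of_dvd (Nat.mul_pos (Nat.gcd_pos_of_pos_left _ hb) (pow_pos hq.pos _)) ?_
    rw [← Nat.gcd_add_self_left, hbc, ← Nat.gcd_mul_right]
    exact Nat.dvd_gcd (Dvd.intro _ rfl) h₁
  have h₃ := pow_card_mul_coeff_le_eval_one hq (polyA_coeff_nonneg l hk) (Finset.univ.sup l) m
  rw [eval_one_polyA] at h₃
  have h₄ : (q : ℤ) ^ S.card * A.coeff (Finset.univ.sup l) ≤ q ^ S.card * Nat.gcd b c := by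
    refine h₃.trans ?_
    rw [mul_comm]
    exact_mod_cast hbc ▸ h₂
  have h₅ := le_of_mul_le_mul_left h₄ (pow_pos (by exact_mod_cast hq.pos) _)
  have h₆ := le_polyA_coeff_sup k b c l
  rw [← hA] at h₆
  omega

/-- If `b + c = q^s` is a prime power, then there is an infinite circulant graph with `k`
distances having a perfect 2-colouring with parameters `(b,c)` if and only if
`b + c ≤ 2k + gcd(b,c)`. -/
theorem stmt6 (k : ℕ) (hk : 1 ≤ k) (b c : ℕ) (hb : 0 < b) (hc : 0 < c)
    (q s : ℕ) (hq : q.Prime) (hs : 0 < s) (hbc : b + c = q ^ s) :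
    (∃ (l : Fin k → ℕ) (f : ℤ → Bool), IsPerfectColouringInt k l b c f) ↔
      b + c ≤ 2 * k + Nat.gcd b c := by
  refine ⟨?_, exists_colouring_of_le hb hq hbc⟩
  rintro ⟨l, f, hf⟩
  exact hf.le_of_prime_pow hb hc hq hbc
end

section
/- Let P ≥ 1 be an integer, let u : ℤ/Pℤ → ℤ be a tile with mask polynomial Q_u(x) = Σ_{a=0}^{P-1} u(a)·x^a ∈ ℤ[x], and let m be a nonzero integer. Define d̃_u(x) = Π Φ_n(x), where the product is over all n dividing P such that n is a prime power and the cyclotomic polynomial Φ_n(x) divides Q_u(x). Then there exists an m-multitiling v : ℤ/Pℤ → ℤ of ℤ/Pℤ with tile u if and only if Q_u(1) divides m·d̃_u(1). -/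
open Polynomial

open scoped Classical

/-- The translation operator `f ↦ (g ↦ f (g - 1))` on functions on `ℤ/Pℤ`. -/
def shiftEnd (P : ℕ) : Module.End ℤ (ZMod P → ℤ) where
  toFun f g := f (g - 1)
  map_add' _ _ := rfl
  map_smul' _ _ := rfl

theorem shiftEnd_pow_apply (P n : ℕ) (f : ZMod P → ℤ) (g : ZMod P) :
    (shiftEnd P ^ n) f g = f (g - n) := by
  induction n generalizing g with
  | zero => simp
  | succ n ih =>
    rw [pow_succ', Module.End.mul_apply]
    change (shiftEnd P ^ n) f (g - 1) = _
    rw [ih]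
    congr 1
    push_cast
    ring

/-- The reduction of a polynomial modulo `X ^ P - 1`, as a function on `ℤ/Pℤ`. -/
noncomputable def foldPoly (P : ℕ) (A : ℤ[X]) : ZMod P → ℤ :=
  aeval (shiftEnd P) A (Pi.single 0 1)

theorem aeval_shiftEnd_maskPoly (P : ℕ) (u f : ZMod P → ℤ) (g : ZMod P) :
    aeval (shiftEnd P) (maskPoly P u) f g =
      ∑ a ∈ Finset.range P, u (a : ZMod P) * f (g - (a : ZMod P)) := by
  simp [maskPoly, LinearMap.sum_apply, Finset.sum_apply, Module.End.mul_apply,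
    shiftEnd_pow_apply]

theorem foldPoly_mul (P : ℕ) (A B : ℤ[X]) :
    foldPoly P (A * B) = aeval (shiftEnd P) A (foldPoly P B) := by
  simp [foldPoly, Module.End.mul_apply]

theorem foldPoly_sub (P : ℕ) (A B : ℤ[X]) :
    foldPoly P (A - B) = foldPoly P A - foldPoly P B := by
  simp [foldPoly]

theorem foldPoly_maskPoly {P : ℕ} (hP : 1 ≤ P) (u : ZMod P → ℤ) :
    foldPoly P (maskPoly P u) = u := by
  have : NeZero P := ⟨by omega⟩
  funext g
  rw [foldPoly, aeval_shiftEnd_maskPoly, Finset.sum_eq_single g.val]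
  · simp
  · intro b hb hbg
    have : g - (b : ZMod P) ≠ 0 := by
      intro h
      apply hbg
      rw [sub_eq_zero.mp h, ZMod.val_natCast, Nat.mod_eq_of_lt (Finset.mem_range.mp hb)]
    simp [Pi.single_eq_of_ne this]
  · intro h
    exact absurd (Finset.mem_range.mpr (ZMod.val_lt g)) h

theorem foldPoly_eq_zero_of_dvd (P : ℕ) {A : ℤ[X]} (h : X ^ P - 1 ∣ A) :
    foldPoly P A = 0 := by
  obtain ⟨B, rfl⟩ := h
  rw [foldPoly_mul]
  funext g
  simp [shiftEnd_pow_apply]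

theorem dvd_of_foldPoly_eq_zero {P : ℕ} (hP : 1 ≤ P) {A : ℤ[X]} (h : foldPoly P A = 0) :
    X ^ P - 1 ∣ A := by
  have hmon : (X ^ P - 1 : ℤ[X]).Monic := monic_X_pow_sub_C 1 (by omega)
  set R := A %ₘ (X ^ P - 1) with hR
  have hdeg : R.natDegree < P := by
    have h1 := natDegree_modByMonic_lt A hmon (by
      intro h1
      have h2 := congrArg natDegree h1
      rw [← C_1, natDegree_X_pow_sub_C, natDegree_C] at h2
      omega)
    rwa [← C_1, natDegree_X_pow_sub_C] at h1
  have hmask : R = maskPoly P (fun z => R.coeff z.val) := by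
    conv_lhs => rw [R.as_sum_range_C_mul_X_pow' hdeg]
    refine Finset.sum_congr rfl fun a ha => ?_
    beta_reduce
    rw [ZMod.val_natCast, Nat.mod_eq_of_lt (Finset.mem_range.mp ha)]
  have hA : R = A - (X ^ P - 1) * (A /ₘ (X ^ P - 1)) := modByMonic_eq_sub_mul_div A _
  have hfold : foldPoly P R = 0 := by
    rw [hA, foldPoly_sub, h, foldPoly_eq_zero_of_dvd P (dvd_mul_right _ _), sub_zero]
  rw [← modByMonic_eq_zero_iff_dvd hmon, ← hR, hmask]
  rw [hmask, foldPoly_maskPoly hP] at hfold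
  rw [hfold]
  simp [maskPoly]

theorem maskPoly_const (P : ℕ) (m : ℤ) :
    maskPoly P (fun _ => m) = C m * ∑ i ∈ Finset.range P, (X : ℤ[X]) ^ i := by
  simp [maskPoly, Finset.mul_sum]

theorem isMultitiling_iff_foldPoly {P : ℕ} (hP : 1 ≤ P) (u v : ZMod P → ℤ) (m : ℤ) :
    IsMultitiling P u v m ↔
      foldPoly P (maskPoly P v * maskPoly P u) = fun _ => m := by
  rw [foldPoly_mul, foldPoly_maskPoly hP, funext_iff]
  refine forall_congr' fun g => ?_
  rw [aeval_shiftEnd_maskPoly]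
  simp only [mul_comm]

/-- Multitilings correspond to polynomial multiples of the mask polynomial of the form
`S * R`, where `S = 1 + X + ⋯ + X ^ (P - 1)` and `R` takes the value `m` at `1`. -/
theorem exists_isMultitiling_iff {P : ℕ} (hP : 1 ≤ P) (u : ZMod P → ℤ) (m : ℤ) :
    (∃ v, IsMultitiling P u v m) ↔
      ∃ V R : ℤ[X], maskPoly P u * V = (∑ i ∈ Finset.range P, X ^ i) * R ∧ R.eval 1 = m := by
  have hgeom : (∑ i ∈ Finset.range P, (X : ℤ[X]) ^ i) * (X - 1) = X ^ P - 1 :=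
    geom_sum_mul X P
  constructor
  · rintro ⟨v, hv⟩
    rw [isMultitiling_iff_foldPoly hP, ← foldPoly_maskPoly hP (fun _ => m), ← sub_eq_zero,
      ← foldPoly_sub] at hv
    obtain ⟨W, hW⟩ := dvd_of_foldPoly_eq_zero hP hv
    rw [← hgeom, maskPoly_const] at hW
    exact ⟨maskPoly P v, C m + (X - 1) * W, by linear_combination hW, by simp⟩
  · rintro ⟨V, R, h, hR⟩
    obtain ⟨W, hW⟩ : X - C 1 ∣ R - C m := by
      rw [dvd_iff_isRoot]
      simp [hR]
    refine ⟨foldPoly P V, ?_⟩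
    rw [isMultitiling_iff_foldPoly hP, mul_comm, foldPoly_mul, foldPoly_maskPoly hP,
      ← foldPoly_mul, ← foldPoly_maskPoly hP (fun _ => m), ← sub_eq_zero, ← foldPoly_sub]
    refine foldPoly_eq_zero_of_dvd P ⟨W, ?_⟩
    rw [C_1] at hW
    rw [maskPoly_const, ← hgeom]
    linear_combination h + (∑ i ∈ Finset.range P, X ^ i) * hW

theorem isRelPrime_cyclotomic_int {m n : ℕ} (hm : 0 < m) (hn : 0 < n) (h : m ≠ n) :
    IsRelPrime (cyclotomic m ℤ) (cyclotomic n ℤ) := by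
  rw [(cyclotomic.irreducible hm).isRelPrime_iff_not_dvd]
  intro hdvd
  have hassoc := (cyclotomic.irreducible hm).associated_of_dvd (cyclotomic.irreducible hn) hdvd
  exact h (cyclotomic_injective
    (eq_of_monic_of_associated (cyclotomic.monic m ℤ) (cyclotomic.monic n ℤ) hassoc))

theorem eval_one_cyclotomic_int_ne_zero {n : ℕ} (hn : 1 < n) :
    (cyclotomic n ℤ).eval 1 ≠ 0 := by
  intro h
  refine (cyclotomic.irreducible one_pos).isRelPrime_iff_not_dvd.mp
    (isRelPrime_cyclotomic_int one_pos (by omega) hn.ne) ?_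
  rwa [cyclotomic_one, ← C_1, dvd_iff_isRoot]

theorem eval_one_cycloProdPP (P : ℕ) (A : ℤ[X]) :
    (cycloProdPP P A).eval 1 =
      (∏ n ∈ (P.divisors.erase 1).filter (fun n => cyclotomic n ℤ ∣ A),
        cyclotomic n ℤ).eval 1 := by
  rw [cycloProdPP, eval_prod, eval_prod]
  refine Finset.prod_subset ?_ ?_
  · intro n hn
    simp only [Finset.mem_filter, Finset.mem_erase] at hn ⊢
    exact ⟨⟨hn.2.1.ne_one, hn.1⟩, hn.2.2⟩
  · intro n hn hn'
    simp only [Finset.mem_filter, Finset.mem_erase] at hn hn'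
    have hpp : ¬ IsPrimePow n := fun h => hn' ⟨hn.1.2, h, hn.2⟩
    refine eval_one_cyclotomic_not_prime_pow fun {p} hp k hk => ?_
    rcases Nat.eq_zero_or_pos k with rfl | hk0
    · exact hn.1.1 (by simpa using hk.symm)
    · exact hpp (hk ▸ hp.isPrimePow.pow (by omega))

/-- For `m ≠ 0`, an `m`-multitiling of `ℤ/Pℤ` with tile `u` exists if and only if
`Q_u(1)` divides `m·d̃_u(1)`. -/
theorem stmt8 (P : ℕ) (hP : 1 ≤ P) (u : ZMod P → ℤ) (m : ℤ) (hm : m ≠ 0) :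
    (∃ v : ZMod P → ℤ, IsMultitiling P u v m) ↔
      (maskPoly P u).eval 1 ∣ m * (cycloProdPP P (maskPoly P u)).eval 1 := by
  rw [exists_isMultitiling_iff hP, eval_one_cycloProdPP]
  set Q := maskPoly P u
  set s := P.divisors.erase 1
  have hs : ∀ n ∈ s, 1 < n := by
    intro n hn
    rw [Finset.mem_erase] at hn
    have := Nat.pos_of_mem_divisors hn.2
    omega
  set D := ∏ n ∈ s.filter (fun n => cyclotomic n ℤ ∣ Q), cyclotomic n ℤ with hD
  set S' := ∏ n ∈ s.filter (fun n => ¬ cyclotomic n ℤ ∣ Q), cyclotomic n ℤ with hS'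
  have hS : ∑ i ∈ Finset.range P, (X : ℤ[X]) ^ i = D * S' := by
    rw [hD, hS', Finset.prod_filter_mul_prod_filter_not, prod_cyclotomic_eq_geom_sum (by omega)]
  have hD1 : D.eval 1 ≠ 0 := by
    rw [hD, eval_prod]
    exact Finset.prod_ne_zero_iff.mpr fun n hn =>
      eval_one_cyclotomic_int_ne_zero (hs n (Finset.mem_filter.mp hn).1)
  have hD0 : D ≠ 0 := fun h => hD1 (by simp [h])
  obtain ⟨Q', hQ'⟩ : D ∣ Q := by
    refine Finset.prod_dvd_of_isRelPrime (fun a ha b hb hab => ?_)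
      fun n hn => (Finset.mem_filter.mp hn).2
    exact isRelPrime_cyclotomic_int (by have := hs a (Finset.mem_filter.mp ha).1; omega)
      (by have := hs b (Finset.mem_filter.mp hb).1; omega) hab
  have hrel : IsRelPrime S' Q' := by
    refine IsRelPrime.prod_left fun n hn => ?_
    rw [Finset.mem_filter] at hn
    have := hs n hn.1
    rw [(cyclotomic.irreducible (by omega)).isRelPrime_iff_not_dvd]
    exact fun h => hn.2 (hQ' ▸ h.mul_left D)
  rw [hS, hQ', eval_mul, mul_comm m, mul_dvd_mul_iff_left hD1]
  constructor
  · rintro ⟨V, R, h, rfl⟩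
    rw [mul_assoc, mul_assoc] at h
    have h := mul_left_cancel₀ hD0 h
    obtain ⟨T, rfl⟩ := hrel.dvd_of_dvd_mul_left (Dvd.intro _ h.symm)
    have hS0 : S' ≠ 0 := by
      rw [hS']
      exact Finset.prod_ne_zero_iff.mpr fun n _ => cyclotomic_ne_zero n ℤ
    have hR : R = Q' * T := mul_left_cancel₀ hS0 (by linear_combination -h)
    rw [hR, eval_mul]
    exact dvd_mul_right _ _
  · rintro ⟨t, rfl⟩
    exact ⟨S' * C t, Q' * C t, by ring, by simp⟩
end
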